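/- Let (v,p) be a smooth axisymmetric solution with no swirl of the steady Navier–Stokes equations on the periodic slab domain D × S¹, satisfying the generalized Dirichlet integral condition with exponent q = 2. Then lim_{r→∞} r^{1/2} sup_{z ∈ [-π,π]} |ω^θ(r,z)| = 0. -/

import Mathlib

open MeasureTheory Real Set Filter Topology

noncomputable section

/-- Three-dimensional Euclidean space. -/
abbrev E3 := EuclideanSpace ℝ (Fin 3)

/-- The distance to the `x₃`-axis, `r = √(x₁² + x₂²)`. -/
def rr (x : E3) : ℝ := Real.sqrt ((x 0) ^ 2 + (x 1) ^ 2)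

/-- Partial derivative of `g : ℝ³ → ℝ` in the `i`-th coordinate direction. -/
def pd (i : Fin 3) (g : E3 → ℝ) (x : E3) : ℝ := fderiv ℝ g x (EuclideanSpace.single i 1)

/-- Partial derivative in the first (radial) variable of a function of `(r,z)`. -/
def dr (f : ℝ → ℝ → ℝ) (r z : ℝ) : ℝ := deriv (fun s => f s z) r

/-- Partial derivative in the second (vertical) variable of a function of `(r,z)`. -/
def dzz (f : ℝ → ℝ → ℝ) (r z : ℝ) : ℝ := deriv (fun t => f r t) z

/-- The azimuthal vorticity `ω^θ = ∂_z v^r − ∂_r v^z` of an axisymmetric vector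
field without swirl, as a function of `(r,z)`. -/
def omTheta (vr vz : ℝ → ℝ → ℝ) (r z : ℝ) : ℝ := dzz vr r z - dr vz r z

/-- The rescaled azimuthal vorticity `Ω = ω^θ / r`. -/
def Om (vr vz : ℝ → ℝ → ℝ) (r z : ℝ) : ℝ := omTheta vr vz r z / r

/-- The squared Frobenius norm `|∇v|² = ∑ᵢⱼ (∂ᵢ vⱼ)²` of the gradient of a
vector field `v : ℝ³ → ℝ³`. -/
def gradSq3 (v : E3 → E3) (x : E3) : ℝ := ∑ i, ∑ j, (pd i (fun y => v y j) x) ^ 2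

/-- `v, p, vr, vz` constitute a smooth axisymmetric solution, without swirl, of the
steady Navier–Stokes equations in the periodic (in `x₃`, with period `2π`) slab
domain `D × S¹`, where `D = {(x₁,x₂) : √(x₁²+x₂²) > r₀}`; the functions `vr, vz`
of `(r,z)` are the cylindrical components of `v`. -/
structure AxisymNoSwirlNSSlab (r₀ : ℝ) (v : E3 → E3) (p : E3 → ℝ)
    (vr vz : ℝ → ℝ → ℝ) : Prop where
  smooth_v : ContDiffOn ℝ (⊤ : ℕ∞) v {x : E3 | r₀ < rr x}
  smooth_p : ContDiffOn ℝ (⊤ : ℕ∞) p {x : E3 | r₀ < rr x}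
  periodic : ∀ x : E3, v (x + (2 * π) • EuclideanSpace.single (2 : Fin 3) (1 : ℝ)) = v x
  axisym_no_swirl : ∀ x : E3, r₀ < rr x →
    v x 0 = vr (rr x) (x 2) * (x 0 / rr x) ∧
    v x 1 = vr (rr x) (x 2) * (x 1 / rr x) ∧
    v x 2 = vz (rr x) (x 2)
  momentum : ∀ x : E3, r₀ < rr x → ∀ j : Fin 3,
    (∑ i, v x i * pd i (fun y => v y j) x) + pd j p x
      = ∑ i, pd i (pd i (fun y => v y j)) x
  incompressible : ∀ x : E3, r₀ < rr x → (∑ i, pd i (fun y => v y i) x) = 0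

/-- Partial derivative in the first variable. -/
def dFst (f : ℝ × ℝ → ℝ) (q : ℝ × ℝ) : ℝ := fderiv ℝ f q (1, 0)

/-- Partial derivative in the second variable. -/
def dSnd (f : ℝ × ℝ → ℝ) (q : ℝ × ℝ) : ℝ := fderiv ℝ f q (0, 1)

section PlaneCalculus

variable {f g : ℝ × ℝ → ℝ}

lemma hasDerivAt_dFst {r z : ℝ} (hf : DifferentiableAt ℝ f (r, z)) :
    HasDerivAt (fun s => f (s, z)) (dFst f (r, z)) r :=
  hf.hasFDerivAt.comp_hasDerivAt (f := fun s : ℝ => (s, z)) r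
    ((hasDerivAt_id r).prodMk (hasDerivAt_const r z))

lemma hasDerivAt_dSnd {r z : ℝ} (hf : DifferentiableAt ℝ f (r, z)) :
    HasDerivAt (fun t => f (r, t)) (dSnd f (r, z)) z :=
  hf.hasFDerivAt.comp_hasDerivAt (f := fun t : ℝ => (r, t)) z
    ((hasDerivAt_const z r).prodMk (hasDerivAt_id z))

lemma ContDiff.dFst (hf : ContDiff ℝ (⊤ : ℕ∞) f) : ContDiff ℝ (⊤ : ℕ∞) (dFst f) :=
  (hf.fderiv_right (m := (⊤ : ℕ∞)) (by simp)).clm_apply contDiff_const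

lemma ContDiff.dSnd (hf : ContDiff ℝ (⊤ : ℕ∞) f) : ContDiff ℝ (⊤ : ℕ∞) (dSnd f) :=
  (hf.fderiv_right (m := (⊤ : ℕ∞)) (by simp)).clm_apply contDiff_const

lemma ContDiff.differentiable_top {E F : Type*} [NormedAddCommGroup E] [NormedSpace ℝ E]
    [NormedAddCommGroup F] [NormedSpace ℝ F] {f : E → F}
    (hf : ContDiff ℝ (⊤ : ℕ∞) f) : Differentiable ℝ f :=
  hf.differentiable (by simp)

lemma dFst_dSnd_comm (hf : ContDiff ℝ (⊤ : ℕ∞) f) (q : ℝ × ℝ) :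
    dFst (dSnd f) q = dSnd (dFst f) q := by
  have hs : IsSymmSndFDerivAt ℝ f q :=
    hf.contDiffAt.isSymmSndFDerivAt (by
      simp only [minSmoothness_of_isRCLikeNormedField]
      exact WithTop.coe_le_coe.2 le_top)
  have hd : DifferentiableAt ℝ (fderiv ℝ f) q :=
    ((hf.fderiv_right (m := (⊤ : ℕ∞)) (by simp)).differentiable_top) q
  have h1 : dFst (dSnd f) q = fderiv ℝ (fderiv ℝ f) q (1, 0) (0, 1) := by
    unfold dFst dSnd
    rw [fderiv_clm_apply hd (by fun_prop)]
    simp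
  have h2 : dSnd (dFst f) q = fderiv ℝ (fderiv ℝ f) q (0, 1) (1, 0) := by
    unfold dFst dSnd
    rw [fderiv_clm_apply hd (by fun_prop)]
    simp
  rw [h1, h2, hs]

lemma dFst_neg (f : ℝ × ℝ → ℝ) : dFst (fun q => -f q) = fun q => -dFst f q := by
  ext q; simp [dFst, fderiv_fun_neg]

lemma dSnd_neg (f : ℝ × ℝ → ℝ) : dSnd (fun q => -f q) = fun q => -dSnd f q := by
  ext q; simp [dSnd, fderiv_fun_neg]

lemma dFst_congr {s : Set ℝ} (hs : IsOpen s) (h : ∀ q : ℝ × ℝ, q.1 ∈ s → f q = g q)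
    {q : ℝ × ℝ} (hq : q.1 ∈ s) : dFst f q = dFst g q := by
  have : f =ᶠ[𝓝 q] g := by
    filter_upwards [(hs.preimage continuous_fst).mem_nhds hq] with x hx using h x hx
  unfold dFst
  rw [this.fderiv_eq]

lemma dSnd_congr {s : Set ℝ} (hs : IsOpen s) (h : ∀ q : ℝ × ℝ, q.1 ∈ s → f q = g q)
    {q : ℝ × ℝ} (hq : q.1 ∈ s) : dSnd f q = dSnd g q := by
  have : f =ᶠ[𝓝 q] g := by
    filter_upwards [(hs.preimage continuous_fst).mem_nhds hq] with x hx using h x hx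
  unfold dSnd
  rw [this.fderiv_eq]

lemma hasDerivAt_integral_slice (hf : ContDiff ℝ (⊤ : ℕ∞) f) (a b r : ℝ) :
    HasDerivAt (fun s => ∫ z in a..b, f (s, z)) (∫ z in a..b, dFst f (r, z)) r := by
  have hc : Continuous (dFst f) := hf.dFst.continuous
  obtain ⟨C, hC⟩ := ((isCompact_Icc (a := r - 1) (b := r + 1)).prod
    (isCompact_uIcc (a := a) (b := b))).exists_bound_of_continuousOn hc.continuousOn
  refine (intervalIntegral.hasDerivAt_integral_of_dominated_loc_of_deriv_le
    (F' := fun s z => dFst f (s, z)) (bound := fun _ => C)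
    (Icc_mem_nhds (by linarith : r - 1 < r) (by linarith : r < r + 1)) ?_ ?_ ?_ ?_ ?_ ?_).2
  · exact Eventually.of_forall fun s =>
      (hf.continuous.comp (by fun_prop : Continuous fun z : ℝ => (s, z))).aestronglyMeasurable
  · exact (hf.continuous.comp
      (by fun_prop : Continuous fun z : ℝ => (r, z))).intervalIntegrable _ _
  · exact (hc.comp (by fun_prop : Continuous fun z : ℝ => (r, z))).aestronglyMeasurable
  · refine Eventually.of_forall fun z hz s hs => hC (s, z) ⟨hs, uIoc_subset_uIcc hz⟩
  · exact intervalIntegrable_const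
  · exact Eventually.of_forall fun z _ s _ => hasDerivAt_dFst (hf.differentiable_top _)

lemma continuous_integral_slice (hf : Continuous f) (a b : ℝ) :
    Continuous fun s => ∫ z in a..b, f (s, z) :=
  intervalIntegral.continuous_parametric_intervalIntegral_of_continuous'
    (f := fun s z => f (s, z)) hf a b

/-- A function of `(r, z)` that is `2π`-periodic in `z`. -/
def PeriodicSnd (f : ℝ × ℝ → ℝ) : Prop := ∀ r z, f (r, z + 2 * π) = f (r, z)

lemma PeriodicSnd.dFst (hf : PeriodicSnd f) : PeriodicSnd (dFst f) := by
  intro r z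
  have : f = fun q => f (q + (0, 2 * π)) := by
    ext ⟨a, b⟩; simpa using (hf a b).symm
  unfold _root_.dFst
  conv_rhs => rw [this, fderiv_comp_add_right]
  simp

lemma PeriodicSnd.dSnd (hf : PeriodicSnd f) : PeriodicSnd (dSnd f) := by
  intro r z
  have : f = fun q => f (q + (0, 2 * π)) := by
    ext ⟨a, b⟩; simpa using (hf a b).symm
  unfold _root_.dSnd
  conv_rhs => rw [this, fderiv_comp_add_right]
  simp

lemma integral_dSnd_eq_zero (hf : ContDiff ℝ (⊤ : ℕ∞) f) (hp : PeriodicSnd f) (r : ℝ) :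
    ∫ z in (-π)..π, dSnd f (r, z) = 0 := by
  rw [intervalIntegral.integral_eq_sub_of_hasDerivAt
    (fun z _ => hasDerivAt_dSnd (hf.differentiable_top _))
    ((hf.dSnd.continuous.comp (by fun_prop : Continuous fun z : ℝ => (r, z))).intervalIntegrable
      _ _)]
  have := hp r (-π)
  rw [show -π + 2 * π = π by ring] at this
  rw [this, sub_self]

lemma PeriodicSnd.exists_mem_Icc (hf : PeriodicSnd f) (z : ℝ) :
    ∃ t ∈ Icc (-π) π, ∀ r, f (r, z) = f (r, t) := by
  refine ⟨toIcoMod Real.two_pi_pos (-π) z, ?_, fun r => ?_⟩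
  · have := toIcoMod_mem_Ico Real.two_pi_pos (-π) z
    exact ⟨this.1, by linarith [this.2]⟩
  · have hp : Function.Periodic (fun t => f (r, t)) (2 * π) := fun t => hf r t
    have := hp.sub_zsmul_eq (toIcoDiv Real.two_pi_pos (-π) z) (x := z)
    exact this.symm

/-- One-dimensional Sobolev inequality with a free weight. -/
lemma sq_le_integral_sq_add {φ φ' : ℝ → ℝ} (hφ : ∀ z, HasDerivAt φ (φ' z) z)
    (hφ' : Continuous φ') {l : ℝ} (hl : 0 < l) {z : ℝ} (hz : z ∈ Icc (-π) π) :
    φ z ^ 2 ≤ (1 + l) * (∫ t in (-π)..π, φ t ^ 2) + l⁻¹ * ∫ t in (-π)..π, φ' t ^ 2 := by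
  have hc : Continuous φ := continuous_iff_continuousAt.2 fun z => (hφ z).continuousAt
  have hpi := Real.pi_gt_three
  set I := ∫ t in (-π)..π, (l * φ t ^ 2 + l⁻¹ * φ' t ^ 2) with hI
  have hIeq : I = l * (∫ t in (-π)..π, φ t ^ 2) + l⁻¹ * ∫ t in (-π)..π, φ' t ^ 2 := by
    rw [hI, intervalIntegral.integral_add, intervalIntegral.integral_const_mul,
      intervalIntegral.integral_const_mul]
    all_goals exact Continuous.intervalIntegrable (by fun_prop) _ _
  have key : ∀ t ∈ Icc (-π) π, φ z ^ 2 - I ≤ φ t ^ 2 := by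
    intro t ht
    have hd : ∫ s in t..z, 2 * φ s * φ' s = φ z ^ 2 - φ t ^ 2 := by
      refine intervalIntegral.integral_eq_sub_of_hasDerivAt (f := fun s => φ s ^ 2) (fun s _ => ?_)
        (Continuous.intervalIntegrable (by fun_prop) _ _)
      simpa using (hφ s).fun_pow 2
    have hb : |∫ s in t..z, 2 * φ s * φ' s| ≤ I := by
      rw [← Real.norm_eq_abs]
      refine (intervalIntegral.norm_integral_le_integral_norm_uIoc).trans ?_
      rw [hI, intervalIntegral.integral_of_le (by linarith : -π ≤ π)]
      have hsub : uIoc t z ⊆ Ioc (-π) π := by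
        intro s hs
        rcases le_total t z with h | h
        · rw [uIoc_of_le h] at hs; exact ⟨ht.1.trans_lt hs.1, hs.2.trans hz.2⟩
        · rw [uIoc_of_ge h] at hs; exact ⟨hz.1.trans_lt hs.1, hs.2.trans ht.2⟩
      have hint : ∀ ψ : ℝ → ℝ, Continuous ψ → IntegrableOn ψ (Ioc (-π) π) := fun ψ hψ =>
        (hψ.integrableOn_Icc).mono_set Ioc_subset_Icc_self
      refine (setIntegral_mono_set (hint _ (by fun_prop)) (ae_of_all _ fun s => norm_nonneg _)
        hsub.eventuallyLE).trans ?_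
      refine setIntegral_mono (hint _ (by fun_prop)) (hint _ (by fun_prop)) fun s => ?_
      rw [Real.norm_eq_abs, abs_le]
      have e1 : 0 ≤ l⁻¹ * (l * φ s - φ' s) ^ 2 := by positivity
      have e2 : 0 ≤ l⁻¹ * (l * φ s + φ' s) ^ 2 := by positivity
      have e3 : l⁻¹ * (l * φ s - φ' s) ^ 2
          = l * φ s ^ 2 + l⁻¹ * φ' s ^ 2 - 2 * φ s * φ' s := by field_simp; ring
      have e4 : l⁻¹ * (l * φ s + φ' s) ^ 2
          = l * φ s ^ 2 + l⁻¹ * φ' s ^ 2 + 2 * φ s * φ' s := by field_simp; ring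
      constructor <;> linarith
    linarith [(abs_le.1 hb).2]
  have h2 : 2 * π * (φ z ^ 2 - I) ≤ ∫ t in (-π)..π, φ t ^ 2 := by
    have := intervalIntegral.integral_mono_on (by linarith : -π ≤ π)
      (intervalIntegrable_const (μ := volume) (c := φ z ^ 2 - I))
      (Continuous.intervalIntegrable (by fun_prop : Continuous fun t => φ t ^ 2) _ _) key
    rw [intervalIntegral.integral_const, smul_eq_mul] at this
    linarith
  have h3 : 0 ≤ ∫ t in (-π)..π, φ t ^ 2 :=
    intervalIntegral.integral_nonneg (by linarith) fun t _ => sq_nonneg _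
  have h4 : φ z ^ 2 - I ≤ ∫ t in (-π)..π, φ t ^ 2 := by
    by_contra! h
    nlinarith
  linarith

end PlaneCalculus

section MaximumPrinciple

/-- Second derivative test at a local maximum. -/
lemma IsLocalMax.second_deriv_nonpos {φ φ' : ℝ → ℝ} {c x : ℝ} (hφ : ∀ y, HasDerivAt φ (φ' y) y)
    (hφ' : HasDerivAt φ' c x) (h : IsLocalMax φ x) : c ≤ 0 := by
  by_contra! hc
  have hd : deriv φ = φ' := funext fun y => (hφ y).deriv
  have h0 : φ' x = 0 := h.hasDerivAt_eq_zero (hφ x)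
  have hmin : IsLocalMin φ x := isLocalMin_of_deriv_deriv_pos (by rwa [hd, hφ'.deriv])
    (by rw [hd, h0]) (hφ x).continuousAt
  have hconst : φ =ᶠ[𝓝 x] fun _ => φ x := by
    filter_upwards [h, hmin] with y h1 h2 using le_antisymm h1 h2
  have hd0 : φ' =ᶠ[𝓝 x] fun _ => 0 := by
    have := hconst.deriv
    rw [hd] at this
    simpa using this
  have : c = 0 := hφ'.unique ((hasDerivAt_const x (0 : ℝ)).congr_of_eventuallyEq hd0)
  linarith

variable {f : ℝ × ℝ → ℝ}

/-- Maximum principle on a periodic strip for elliptic operators without zeroth order term. -/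
lemma le_of_le_on_boundary (hf : ContDiff ℝ (⊤ : ℕ∞) f) (hp : PeriodicSnd f)
    {β γ : ℝ × ℝ → ℝ} {a b B M : ℝ}
    (hβ : ∀ q : ℝ × ℝ, q.1 ∈ Ioo a b → β q ≤ B)
    (heq : ∀ q : ℝ × ℝ, q.1 ∈ Ioo a b →
      dFst (dFst f) q + dSnd (dSnd f) q = β q * dFst f q + γ q * dSnd f q)
    (ha : ∀ z, f (a, z) ≤ M) (hb : ∀ z, f (b, z) ≤ M) {r : ℝ} (hr : r ∈ Icc a b) (z : ℝ) :
    f (r, z) ≤ M := by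
  by_contra! hM
  set k : ℝ := max B 0 + 1 with hk
  have hk0 : 0 < k := by positivity
  have hkB : B < k := by rw [hk]; linarith [le_max_left B 0]
  set ε : ℝ := (f (r, z) - M) / 2 * exp (-(k * b)) with hε
  have hε0 : 0 < ε := mul_pos (by linarith) (exp_pos _)
  have hεb : ε * exp (k * b) = (f (r, z) - M) / 2 := by
    rw [hε, mul_assoc, ← exp_add]; simp
  set h : ℝ × ℝ → ℝ := fun q => f q + ε * exp (k * q.1) with hh
  have hhc : Continuous h := by
    have := hf.continuous
    fun_prop
  obtain ⟨⟨x, y⟩, ⟨hx, hy⟩, hmax⟩ := ((isCompact_Icc (a := a) (b := b)).prod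
    (isCompact_Icc (a := -π) (b := π))).exists_isMaxOn
    ⟨(r, 0), hr, by constructor <;> linarith [Real.pi_pos]⟩ hhc.continuousOn
  have hmax' : ∀ s ∈ Icc a b, ∀ t, h (s, t) ≤ h (x, y) := by
    intro s hs t
    obtain ⟨t', ht', he⟩ := hp.exists_mem_Icc t
    have : h (s, t) = h (s, t') := by simp only [hh, he]
    rw [this]
    exact hmax (show (s, t') ∈ Icc a b ×ˢ Icc (-π) π from ⟨hs, ht'⟩)
  have hbig : M + ε * exp (k * b) < h (x, y) := by
    refine lt_of_lt_of_le ?_ (hmax' r hr z)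
    have : 0 < ε * exp (k * r) := by positivity
    simp only [hh]
    linarith
  have hxle : ε * exp (k * x) ≤ ε * exp (k * b) := by
    have := hx.2
    gcongr
  have hx' : x ∈ Ioo a b := by
    refine ⟨lt_of_le_of_ne hx.1 ?_, lt_of_le_of_ne hx.2 ?_⟩
    · rintro rfl
      have := ha y
      simp only [hh] at hbig
      linarith
    · rintro rfl
      have := hb y
      simp only [hh] at hbig
      linarith
  have hexp : ∀ s, HasDerivAt (fun s => ε * exp (k * s)) (ε * k * exp (k * s)) s := fun s => by
    have := (((hasDerivAt_id s).const_mul k).exp).const_mul ε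
    exact this.congr_deriv (by rw [id]; ring)
  have hd1 : ∀ s, HasDerivAt (fun s => h (s, y)) (dFst f (s, y) + ε * k * exp (k * s)) s :=
    fun s => (hasDerivAt_dFst (hf.differentiable_top _)).add (hexp s)
  have hd2 : HasDerivAt (fun s => dFst f (s, y) + ε * k * exp (k * s))
      (dFst (dFst f) (x, y) + k * (ε * k * exp (k * x))) x := by
    refine (hasDerivAt_dFst (hf.dFst.differentiable_top _)).add ?_
    have he : (fun s => ε * k * exp (k * s)) = fun s => k * (ε * exp (k * s)) := by
      ext s; ring
    rw [he]
    exact (hexp x).const_mul k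
  have ht1 : ∀ t, HasDerivAt (fun t => h (x, t)) (dSnd f (x, t)) t := fun t => by
    exact (hasDerivAt_dSnd (hf.differentiable_top (x, t))).add_const (ε * exp (k * x))
  have ht2 : HasDerivAt (fun t => dSnd f (x, t)) (dSnd (dSnd f) (x, y)) y :=
    hasDerivAt_dSnd (hf.dSnd.differentiable_top _)
  have hl1 : IsLocalMax (fun s => h (s, y)) x := by
    filter_upwards [Icc_mem_nhds hx'.1 hx'.2] with s hs using hmax' s hs y
  have hl2 : IsLocalMax (fun t => h (x, t)) y :=
    Eventually.of_forall fun t => hmax' x hx t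
  have e1 := hl1.hasDerivAt_eq_zero (hd1 x)
  have e2 := hl2.hasDerivAt_eq_zero (ht1 y)
  have e3 := hl1.second_deriv_nonpos hd1 hd2
  have e4 := hl2.second_deriv_nonpos ht1 ht2
  have e5 := heq (x, y) hx'
  have e6 := hβ (x, y) hx'
  rw [e2, mul_zero, add_zero] at e5
  have e7 : 0 < ε * k * exp (k * x) := by positivity
  have e8 : dFst f (x, y) = -(ε * k * exp (k * x)) := by linarith
  rw [e8] at e5
  nlinarith

end MaximumPrinciple

lemma intervalIntegral_swap_of_continuous {f : ℝ × ℝ → ℝ} (hf : Continuous f) {a b c d : ℝ}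
    (hab : a ≤ b) (hcd : c ≤ d) :
    ∫ z in c..d, ∫ s in a..b, f (s, z) = ∫ s in a..b, ∫ z in c..d, f (s, z) := by
  simp only [intervalIntegral.integral_of_le hab, intervalIntegral.integral_of_le hcd]
  refine (integral_integral_swap (f := fun s z => f (s, z)) ?_).symm
  rw [Measure.prod_restrict]
  exact (hf.continuousOn.integrableOn_compact
    ((isCompact_Icc (a := a) (b := b)).prod (isCompact_Icc (a := c) (b := d)))).mono_set
    (prod_mono Ioc_subset_Icc_self Ioc_subset_Icc_self)

/-- A smooth axisymmetric no-swirl flow in the meridian half-plane, `2π`-periodic in `z`, with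
radial velocity `u`, vertical velocity `w` and rescaled vorticity `Ω`. The incompressibility
and vorticity equations hold for `r ≥ R₁`, and the Dirichlet integral is finite there. -/
structure MeridianFlow (R₁ : ℝ) (u w Ω : ℝ × ℝ → ℝ) : Prop where
  one_le : 1 ≤ R₁
  smooth_u : ContDiff ℝ (⊤ : ℕ∞) u
  smooth_w : ContDiff ℝ (⊤ : ℕ∞) w
  smooth_Om : ContDiff ℝ (⊤ : ℕ∞) Ω
  periodic_w : PeriodicSnd w
  periodic_u : PeriodicSnd u
  periodic_Om : PeriodicSnd Ω
  div_eq : ∀ q : ℝ × ℝ, R₁ ≤ q.1 → q.1 * dFst u q + u q + q.1 * dSnd w q = 0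
  vort_eq : ∀ q : ℝ × ℝ, R₁ ≤ q.1 → q.1 * (u q * dFst Ω q + w q * dSnd Ω q)
    = q.1 * dFst (dFst Ω) q + 3 * dFst Ω q + q.1 * dSnd (dSnd Ω) q
  dirichlet_w : ∃ M, ∀ R, R₁ ≤ R → ∫ r in R₁..R, ∫ z in (-π)..π, r * dSnd w (r, z) ^ 2 ≤ M
  dirichlet_Om : ∃ M, ∀ R, R₁ ≤ R → ∫ r in R₁..R, ∫ z in (-π)..π, r ^ 3 * Ω (r, z) ^ 2 ≤ M

namespace MeridianFlow

variable {R₁ : ℝ} {u w Ω : ℝ × ℝ → ℝ}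

lemma exists_flux_bound (h : MeridianFlow R₁ u w Ω) :
    ∃ C, 0 < C ∧ ∀ r, R₁ ≤ r → r * ∫ z in (-π)..π, |u (r, z)| ≤ C * r ^ 2 := by
  obtain ⟨M, hM⟩ := h.dirichlet_w
  have hpi := Real.pi_pos
  have hu := h.smooth_u.continuous
  have hw := h.smooth_w.dSnd.continuous
  have h1 := h.one_le
  have hA0 : 0 ≤ ∫ z in (-π)..π, |u (R₁, z)| :=
    intervalIntegral.integral_nonneg (by linarith) fun t _ => abs_nonneg _
  set A₀ := ∫ z in (-π)..π, |u (R₁, z)|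
  refine ⟨R₁ * A₀ + π + |M|, by positivity, fun r hr => ?_⟩
  have hptw : ∀ z, r * |u (r, z)| ≤ R₁ * |u (R₁, z)|
      + ∫ s in R₁..r, (s + s * dSnd w (s, z) ^ 2) := by
    intro z
    have hd : ∫ s in R₁..r, -(s * dSnd w (s, z)) = r * u (r, z) - R₁ * u (R₁, z) := by
      refine intervalIntegral.integral_eq_sub_of_hasDerivAt (f := fun s => s * u (s, z))
        (fun s hs => ?_) (Continuous.intervalIntegrable (by fun_prop) _ _)
      rw [uIcc_of_le hr] at hs
      refine ((hasDerivAt_id s).mul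
        (hasDerivAt_dFst (h.smooth_u.differentiable_top (s, z)))).congr_deriv ?_
      have := h.div_eq (s, z) hs.1
      simp only [id] at this ⊢
      linarith
    have hb : |∫ s in R₁..r, -(s * dSnd w (s, z))| ≤ ∫ s in R₁..r, (s + s * dSnd w (s, z) ^ 2) := by
      refine (intervalIntegral.abs_integral_le_integral_abs hr).trans ?_
      refine intervalIntegral.integral_mono_on hr (Continuous.intervalIntegrable (by fun_prop) _ _)
        (Continuous.intervalIntegrable (by fun_prop) _ _) fun s hs => ?_
      have hs0 : 0 < s := by linarith [hs.1]
      rw [abs_neg, abs_mul, abs_of_pos hs0]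
      have : |dSnd w (s, z)| ≤ 1 + dSnd w (s, z) ^ 2 := by
        rw [← sq_abs]; nlinarith [sq_nonneg (|dSnd w (s, z)| - 1), abs_nonneg (dSnd w (s, z))]
      nlinarith
    rw [hd] at hb
    have e1 : r * |u (r, z)| = |r * u (r, z)| := by rw [abs_mul, abs_of_pos (by linarith : 0 < r)]
    have e2 : R₁ * |u (R₁, z)| = |R₁ * u (R₁, z)| := by
      rw [abs_mul, abs_of_pos (by linarith : 0 < R₁)]
    rw [e1, e2]
    linarith [abs_sub_abs_le_abs_sub (r * u (r, z)) (R₁ * u (R₁, z))]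
  have hcont : Continuous fun z => ∫ s in R₁..r, (s + s * dSnd w (s, z) ^ 2) :=
    intervalIntegral.continuous_parametric_intervalIntegral_of_continuous'
      (f := fun z s => s + s * dSnd w (s, z) ^ 2)
      (show Continuous fun p : ℝ × ℝ => p.2 + p.2 * dSnd w (p.2, p.1) ^ 2 by fun_prop) _ _
  have hint := intervalIntegral.integral_mono (μ := volume) (by linarith : -π ≤ π)
    (Continuous.intervalIntegrable (by fun_prop) _ _)
    (Continuous.intervalIntegrable (by fun_prop) _ _) hptw
  rw [intervalIntegral.integral_const_mul, intervalIntegral.integral_add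
    (Continuous.intervalIntegrable (by fun_prop) _ _)
    (Continuous.intervalIntegrable (by fun_prop) _ _), intervalIntegral.integral_const_mul,
    intervalIntegral_swap_of_continuous (f := fun q => q.1 + q.1 * dSnd w q ^ 2) (by fun_prop) hr
      (by linarith)] at hint
  have hsplit : ∫ s in R₁..r, ∫ z in (-π)..π, (s + s * dSnd w (s, z) ^ 2)
      = π * (r ^ 2 - R₁ ^ 2) + ∫ s in R₁..r, ∫ z in (-π)..π, s * dSnd w (s, z) ^ 2 := by
    have hc := continuous_integral_slice (f := fun q => q.1 * dSnd w q ^ 2) (by fun_prop) (-π) π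
    have : ∀ s, ∫ z in (-π)..π, (s + s * dSnd w (s, z) ^ 2)
        = 2 * π * s + ∫ z in (-π)..π, s * dSnd w (s, z) ^ 2 := by
      intro s
      rw [intervalIntegral.integral_add intervalIntegrable_const
        (Continuous.intervalIntegrable (by fun_prop) _ _), intervalIntegral.integral_const,
        smul_eq_mul]
      ring
    simp only [this]
    rw [intervalIntegral.integral_add (Continuous.intervalIntegrable (by fun_prop) _ _)
      (hc.intervalIntegrable _ _), intervalIntegral.integral_const_mul, integral_id]
    ring
  simp only at hint
  rw [hsplit] at hint
  have hM' := (hM r hr).trans (le_abs_self M)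
  have hr2 : 1 ≤ r ^ 2 := by nlinarith
  have : R₁ * A₀ ≤ R₁ * A₀ * r ^ 2 := le_mul_of_one_le_right (by positivity) hr2
  have : |M| ≤ |M| * r ^ 2 := le_mul_of_one_le_right (by positivity) hr2
  have : 0 ≤ π * R₁ ^ 2 := by positivity
  linarith

/-- The flux whose radial derivative is the weighted enstrophy dissipation. -/
def flux (u Ω : ℝ × ℝ → ℝ) (q : ℝ × ℝ) : ℝ :=
  q.1 * Ω q * dFst Ω q + Ω q ^ 2 - q.1 * u q * Ω q ^ 2 / 2

lemma contDiff_flux (h : MeridianFlow R₁ u w Ω) : ContDiff ℝ (⊤ : ℕ∞) (flux u Ω) := by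
  have h1 := h.smooth_u
  have h2 := h.smooth_Om
  have h3 := h.smooth_Om.dFst
  unfold flux
  fun_prop

lemma dFst_flux (h : MeridianFlow R₁ u w Ω) {q : ℝ × ℝ} (hq : R₁ ≤ q.1) :
    dFst (flux u Ω) q = q.1 * (dFst Ω q ^ 2 + dSnd Ω q ^ 2)
      + dSnd (fun q => q.1 * w q * Ω q ^ 2 / 2 - q.1 * Ω q * dSnd Ω q) q := by
  obtain ⟨r, z⟩ := q
  have hO := h.smooth_Om
  have hw := h.smooth_w
  have hO2 := h.smooth_Om.dSnd
  have hOr := hasDerivAt_dFst (hO.differentiable_top (r, z))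
  have hOrr := hasDerivAt_dFst (hO.dFst.differentiable_top (r, z))
  have hur := hasDerivAt_dFst (h.smooth_u.differentiable_top (r, z))
  have hOz := hasDerivAt_dSnd (hO.differentiable_top (r, z))
  have hOzz := hasDerivAt_dSnd (hO.dSnd.differentiable_top (r, z))
  have hwz := hasDerivAt_dSnd (h.smooth_w.differentiable_top (r, z))
  have e1 := (hasDerivAt_dFst (h.contDiff_flux.differentiable_top (r, z))).unique
    (((((hasDerivAt_id r).mul hOr).mul hOrr).add (hOr.fun_pow 2)).sub
      ((((hasDerivAt_id r).mul hur).mul (hOr.fun_pow 2)).div_const 2))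
  have hs : ContDiff ℝ (⊤ : ℕ∞) (fun q : ℝ × ℝ => q.1 * w q * Ω q ^ 2 / 2 - q.1 * Ω q * dSnd Ω q) := by
    fun_prop
  have e2 := (hasDerivAt_dSnd (hs.differentiable_top (r, z))).unique
    ((((hwz.const_mul r).mul (hOz.fun_pow 2)).div_const 2).sub ((hOz.const_mul r).mul hOzz))
  rw [e1, e2]
  have e3 := h.div_eq (r, z) hq
  have e4 := h.vort_eq (r, z) hq
  simp only [id, Pi.mul_apply, Nat.cast_ofNat] at e3 e4 ⊢
  linear_combination (-(1 : ℝ) / 2 * Ω (r, z) ^ 2) * e3 - Ω (r, z) * e4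

lemma hasDerivAt_integral_flux (h : MeridianFlow R₁ u w Ω) {r : ℝ} (hr : R₁ ≤ r) :
    HasDerivAt (fun s => ∫ z in (-π)..π, flux u Ω (s, z))
      (r * ((∫ z in (-π)..π, dFst Ω (r, z) ^ 2) + ∫ z in (-π)..π, dSnd Ω (r, z) ^ 2)) r := by
  refine (hasDerivAt_integral_slice h.contDiff_flux _ _ r).congr_deriv ?_
  have hO := h.smooth_Om
  have hw := h.smooth_w
  have hO1 := hO.dFst
  have hO2 := hO.dSnd
  have c1 := hO1.continuous
  have c2 := hO2.continuous
  have hs : ContDiff ℝ (⊤ : ℕ∞) (fun q : ℝ × ℝ => q.1 * w q * Ω q ^ 2 / 2 - q.1 * Ω q * dSnd Ω q) := by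
    fun_prop
  have c3 := hs.dSnd.continuous
  have hp : PeriodicSnd (fun q : ℝ × ℝ => q.1 * w q * Ω q ^ 2 / 2 - q.1 * Ω q * dSnd Ω q) := by
    intro r z
    simp only [h.periodic_w r z, h.periodic_Om r z, h.periodic_Om.dSnd r z]
  simp only [h.dFst_flux (q := (r, _)) hr]
  rw [intervalIntegral.integral_add (Continuous.intervalIntegrable (by fun_prop) _ _)
    (Continuous.intervalIntegrable (by fun_prop) _ _), integral_dSnd_eq_zero hs hp, add_zero,
    intervalIntegral.integral_const_mul, intervalIntegral.integral_add
    (Continuous.intervalIntegrable (by fun_prop) _ _)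
    (Continuous.intervalIntegrable (by fun_prop) _ _)]

end MeridianFlow

namespace MeridianFlow

variable {R₁ : ℝ} {u w Ω : ℝ × ℝ → ℝ}

lemma neg_mul_integral_flux_le (h : MeridianFlow R₁ u w Ω) {C : ℝ} (hC : 0 < C)
    (hflux : ∀ r, R₁ ≤ r → r * ∫ z in (-π)..π, |u (r, z)| ≤ C * r ^ 2) {r η d : ℝ} (hr : R₁ ≤ r)
    (hη0 : 0 ≤ η) (hη : η ≤ 3) (hd : |d| * r ≤ 12) :
    -(2 * η * d * ∫ z in (-π)..π, flux u Ω (r, z)) ≤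
      1 / 2 * (η ^ 2 * (r * ((∫ z in (-π)..π, dFst Ω (r, z) ^ 2)
        + ∫ z in (-π)..π, dSnd Ω (r, z) ^ 2)))
      + (360 + 12 * C * (3 + 24 * C)) * (r * ∫ z in (-π)..π, Ω (r, z) ^ 2) := by
  have hpi := Real.pi_pos
  have hr1 : 1 ≤ r := h.one_le.trans hr
  have cu := h.smooth_u.continuous
  have cO := h.smooth_Om.continuous
  have cO1 := h.smooth_Om.dFst.continuous
  have cO2 := h.smooth_Om.dSnd.continuous
  have hH : 0 ≤ ∫ z in (-π)..π, Ω (r, z) ^ 2 :=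
    intervalIntegral.integral_nonneg (by linarith) fun t _ => sq_nonneg _
  have hm : 0 ≤ ∫ z in (-π)..π, dFst Ω (r, z) ^ 2 :=
    intervalIntegral.integral_nonneg (by linarith) fun t _ => sq_nonneg _
  have hk : 0 ≤ ∫ z in (-π)..π, dSnd Ω (r, z) ^ 2 :=
    intervalIntegral.integral_nonneg (by linarith) fun t _ => sq_nonneg _
  rcases hη0.eq_or_lt with rfl | hηpos
  · simp only [mul_zero, zero_mul, neg_zero, ne_eq, OfNat.ofNat_ne_zero, not_false_eq_true,
      zero_pow, zero_add]
    positivity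
  set l : ℝ := 24 * C / η with hl
  have hl0 : 0 < l := by positivity
  have hsob : ∀ z ∈ Icc (-π) π, Ω (r, z) ^ 2 ≤ (1 + l) * (∫ z in (-π)..π, Ω (r, z) ^ 2)
      + l⁻¹ * ∫ z in (-π)..π, dSnd Ω (r, z) ^ 2 := fun z hz =>
    sq_le_integral_sq_add (φ := fun z => Ω (r, z)) (φ' := fun z => dSnd Ω (r, z))
      (fun z => hasDerivAt_dSnd (h.smooth_Om.differentiable_top _)) (by fun_prop) hl0 hz
  set H := ∫ z in (-π)..π, Ω (r, z) ^ 2 with hHdef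
  set m := ∫ z in (-π)..π, dFst Ω (r, z) ^ 2 with hmdef
  set k := ∫ z in (-π)..π, dSnd Ω (r, z) ^ 2 with hkdef
  set S := (1 + l) * H + l⁻¹ * k with hS
  have hS0 : 0 ≤ S := by positivity
  have hsplit : 2 * η * d * ∫ z in (-π)..π, flux u Ω (r, z)
      = (∫ z in (-π)..π, 2 * η * d * (r * Ω (r, z) * dFst Ω (r, z))) + 2 * η * d * H
        - η * d * ∫ z in (-π)..π, r * u (r, z) * Ω (r, z) ^ 2 := by
    unfold flux
    rw [intervalIntegral.integral_sub (Continuous.intervalIntegrable (by fun_prop) _ _)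
      (Continuous.intervalIntegrable (by fun_prop) _ _),
      intervalIntegral.integral_add (Continuous.intervalIntegrable (by fun_prop) _ _)
      (Continuous.intervalIntegrable (by fun_prop) _ _), intervalIntegral.integral_div,
      intervalIntegral.integral_const_mul]
    ring
  have hd2 : d ^ 2 * r ≤ 144 * r := by
    have h0 : 0 ≤ |d| * r := by positivity
    have : d ^ 2 * r ^ 2 ≤ 144 := by
      rw [← sq_abs d]; nlinarith
    nlinarith [sq_nonneg d]
  have hdr : |d| ≤ 12 * r := by nlinarith [abs_nonneg d]
  have t1 : -(∫ z in (-π)..π, 2 * η * d * (r * Ω (r, z) * dFst Ω (r, z)))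
      ≤ 1 / 2 * (η ^ 2 * (r * m)) + 288 * (r * H) := by
    have : ∫ z in (-π)..π, (1 / 2 * (η ^ 2 * (r * dFst Ω (r, z) ^ 2))
        + 2 * (d ^ 2 * r) * Ω (r, z) ^ 2) = 1 / 2 * (η ^ 2 * (r * m)) + 2 * (d ^ 2 * r) * H := by
      rw [intervalIntegral.integral_add (Continuous.intervalIntegrable (by fun_prop) _ _)
        (Continuous.intervalIntegrable (by fun_prop) _ _)]
      simp only [intervalIntegral.integral_const_mul, ← hHdef, ← hmdef]
    have hle : ∫ z in (-π)..π, -(2 * η * d * (r * Ω (r, z) * dFst Ω (r, z)))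
        ≤ ∫ z in (-π)..π, (1 / 2 * (η ^ 2 * (r * dFst Ω (r, z) ^ 2))
        + 2 * (d ^ 2 * r) * Ω (r, z) ^ 2) := by
      refine intervalIntegral.integral_mono (by linarith)
        (Continuous.intervalIntegrable (by fun_prop) _ _)
        (Continuous.intervalIntegrable (by fun_prop) _ _) fun z => ?_
      have : 0 ≤ r * (η * dFst Ω (r, z) + 2 * d * Ω (r, z)) ^ 2 := by positivity
      simp only
      nlinarith
    rw [this, intervalIntegral.integral_neg] at hle
    nlinarith
  have t2 : -(2 * η * d * H) ≤ 72 * (r * H) := by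
    have : -(η * d) ≤ 36 * r := by nlinarith [neg_abs_le d, abs_nonneg d]
    nlinarith
  have t3 : η * d * (∫ z in (-π)..π, r * u (r, z) * Ω (r, z) ^ 2)
      ≤ 12 * C * (3 + 24 * C) * (r * H) + 1 / 2 * (η ^ 2 * (r * k)) := by
    have hb : |∫ z in (-π)..π, r * u (r, z) * Ω (r, z) ^ 2| ≤ C * r ^ 2 * S := by
      refine (intervalIntegral.abs_integral_le_integral_abs (by linarith)).trans ?_
      have : ∫ z in (-π)..π, |r * u (r, z) * Ω (r, z) ^ 2|
          ≤ ∫ z in (-π)..π, r * S * |u (r, z)| := by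
        refine intervalIntegral.integral_mono_on (by linarith)
          (Continuous.intervalIntegrable (by fun_prop) _ _)
          (Continuous.intervalIntegrable (by fun_prop) _ _) fun z hz => ?_
        rw [abs_mul, abs_mul, abs_of_pos (by linarith : 0 < r), abs_of_nonneg (sq_nonneg (Ω (r, z)))]
        have := mul_le_mul_of_nonneg_left (hsob z hz) (by positivity : 0 ≤ r * |u (r, z)|)
        linarith
      rw [intervalIntegral.integral_const_mul] at this
      have := mul_le_mul_of_nonneg_right (hflux r hr) hS0
      linarith
    have e1 : η * d * (∫ z in (-π)..π, r * u (r, z) * Ω (r, z) ^ 2) ≤ η * |d| * (C * r ^ 2 * S) := by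
      refine (le_abs_self _).trans ?_
      rw [abs_mul, abs_mul, abs_of_pos hηpos]
      gcongr
    have e2 : η * |d| * (C * r ^ 2 * S) ≤ 12 * C * r * (η * S) := by
      have := mul_le_mul_of_nonneg_right hd (by positivity : 0 ≤ C * r * (η * S))
      linarith
    have e3 : η * S = (η + 24 * C) * H + η ^ 2 / (24 * C) * k := by
      rw [hS, hl]; field_simp
    have e4 : 12 * C * r * (η * S) = 12 * C * (η + 24 * C) * (r * H) + 1 / 2 * (η ^ 2 * (r * k)) := by
      rw [e3]; field_simp; ring
    have e5 : 12 * C * (η + 24 * C) * (r * H) ≤ 12 * C * (3 + 24 * C) * (r * H) := by gcongr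
    linarith
  rw [hsplit]
  linarith

/-- Interior estimate of the dissipation on dyadic annuli. -/
lemma exists_dissipation_bound (h : MeridianFlow R₁ u w Ω) :
    ∃ K, 0 < K ∧ ∀ R, R₁ ≤ R →
      ∫ r in (2 * R)..(3 * R), r * ((∫ z in (-π)..π, dFst Ω (r, z) ^ 2)
        + ∫ z in (-π)..π, dSnd Ω (r, z) ^ 2)
      ≤ K * ∫ r in R..(4 * R), r * ∫ z in (-π)..π, Ω (r, z) ^ 2 := by
  obtain ⟨C, hC, hflux⟩ := h.exists_flux_bound
  refine ⟨2 * (360 + 12 * C * (3 + 24 * C)), by positivity, fun R hR => ?_⟩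
  have hR1 : 1 ≤ R := h.one_le.trans hR
  set K := 360 + 12 * C * (3 + 24 * C)
  have cO := h.smooth_Om.continuous
  have cO1 := h.smooth_Om.dFst.continuous
  have cO2 := h.smooth_Om.dSnd.continuous
  have cF := h.contDiff_flux.continuous
  have cG := continuous_integral_slice (f := flux u Ω) cF (-π) π
  have cm := continuous_integral_slice (f := fun q => dFst Ω q ^ 2) (by fun_prop) (-π) π
  have ck := continuous_integral_slice (f := fun q => dSnd Ω q ^ 2) (by fun_prop) (-π) π
  have cH := continuous_integral_slice (f := fun q => Ω q ^ 2) (by fun_prop) (-π) π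
  set G : ℝ → ℝ := fun r => ∫ z in (-π)..π, flux u Ω (r, z) with hG
  set D : ℝ → ℝ := fun r => r * ((∫ z in (-π)..π, dFst Ω (r, z) ^ 2)
        + ∫ z in (-π)..π, dSnd Ω (r, z) ^ 2) with hD
  set H : ℝ → ℝ := fun r => r * ∫ z in (-π)..π, Ω (r, z) ^ 2 with hH
  have cD : Continuous D := by simp only [hD]; fun_prop
  have cHr : Continuous H := by simp only [hH]; fun_prop
  have hpi := Real.pi_pos
  have hD0 : ∀ r, R₁ ≤ r → 0 ≤ D r := fun r hr => by
    have hr1 : 1 ≤ r := h.one_le.trans hr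
    have hm : 0 ≤ ∫ z in (-π)..π, dFst Ω (r, z) ^ 2 :=
      intervalIntegral.integral_nonneg (by linarith) fun t _ => sq_nonneg _
    have hk : 0 ≤ ∫ z in (-π)..π, dSnd Ω (r, z) ^ 2 :=
      intervalIntegral.integral_nonneg (by linarith) fun t _ => sq_nonneg _
    simp only [hD]
    positivity
  set η : ℝ → ℝ := fun r => (r - R) * (4 * R - r) / R ^ 2 with hη
  set d : ℝ → ℝ := fun r => (5 * R - 2 * r) / R ^ 2 with hd
  have cη : Continuous η := by simp only [hη]; fun_prop
  have cd : Continuous d := by simp only [hd]; fun_prop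
  have hηd : ∀ r, HasDerivAt η (d r) r := fun r => by
    have := ((((hasDerivAt_id r).sub_const R).mul ((hasDerivAt_id r).const_sub (4 * R))).div_const
      (R ^ 2))
    refine this.congr_deriv ?_
    simp only [hd, id]; ring
  have hη0 : ∀ r ∈ Icc R (4 * R), 0 ≤ η r := fun r hr => by
    have := hr.1; have := hr.2
    exact div_nonneg (mul_nonneg (by linarith) (by linarith)) (by positivity)
  have hη3 : ∀ r, η r ≤ 3 := fun r => by
    simp only [hη]
    rw [div_le_iff₀ (by positivity)]
    nlinarith [sq_nonneg (2 * r - 5 * R)]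
  have hdr : ∀ r ∈ Icc R (4 * R), |d r| * r ≤ 12 := fun r hr => by
    have h1 := hr.1; have h2 := hr.2
    simp only [hd]
    rw [abs_div, abs_of_pos (by positivity : 0 < R ^ 2), div_mul_eq_mul_div,
      div_le_iff₀ (by positivity)]
    have : |5 * R - 2 * r| ≤ 3 * R := by rw [abs_le]; constructor <;> linarith
    nlinarith [abs_nonneg (5 * R - 2 * r)]
  have hparts := intervalIntegral.integral_mul_deriv_eq_deriv_mul (a := R) (b := 4 * R)
    (u := fun r => η r ^ 2) (u' := fun r => 2 * η r * d r) (v := G) (v' := D)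
    (fun r _ => by simpa using (hηd r).fun_pow 2)
    (fun r hr => h.hasDerivAt_integral_flux (by
      rw [uIcc_of_le (by linarith)] at hr; exact hR.trans hr.1))
    (Continuous.intervalIntegrable (by fun_prop) _ _)
    (Continuous.intervalIntegrable (by fun_prop) _ _)
  have hz1 : η R = 0 := by simp [hη]
  have hz2 : η (4 * R) = 0 := by simp [hη]
  rw [hz1, hz2] at hparts
  have hle : ∫ r in R..(4 * R), -(2 * η r * d r * G r)
      ≤ ∫ r in R..(4 * R), (1 / 2 * (η r ^ 2 * D r) + K * H r) := by
    refine intervalIntegral.integral_mono_on (by linarith)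
      (Continuous.intervalIntegrable (by fun_prop) _ _)
      (Continuous.intervalIntegrable (by fun_prop) _ _) fun r hr => ?_
    exact h.neg_mul_integral_flux_le hC hflux (hR.trans hr.1) (hη0 r hr) (hη3 r) (hdr r hr)
  rw [intervalIntegral.integral_neg, intervalIntegral.integral_add
    (Continuous.intervalIntegrable (by fun_prop) _ _)
    (Continuous.intervalIntegrable (by fun_prop) _ _), intervalIntegral.integral_const_mul,
    intervalIntegral.integral_const_mul] at hle
  have hin : ∫ r in (2 * R)..(3 * R), D r ≤ ∫ r in R..(4 * R), η r ^ 2 * D r := by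
    have h1 : ∫ r in (2 * R)..(3 * R), D r ≤ ∫ r in (2 * R)..(3 * R), η r ^ 2 * D r := by
      refine intervalIntegral.integral_mono_on (by linarith)
        (Continuous.intervalIntegrable (by fun_prop) _ _)
        (Continuous.intervalIntegrable (by fun_prop) _ _) fun r hr => ?_
      have h1 := hr.1; have h2 := hr.2
      have : 1 ≤ η r := by
        simp only [hη]
        rw [le_div_iff₀ (by positivity)]
        nlinarith [mul_nonneg (by linarith : 0 ≤ r - 2 * R) (by linarith : 0 ≤ 3 * R - r)]
      have hDr := hD0 r (by linarith)
      have : 1 ≤ η r ^ 2 := by nlinarith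
      nlinarith
    refine h1.trans (intervalIntegral.integral_mono_interval (by linarith) (by linarith)
      (by linarith) ?_ (Continuous.intervalIntegrable (by fun_prop) _ _))
    filter_upwards [ae_restrict_mem measurableSet_Ioc] with r hr
    have := hD0 r (hR.trans hr.1.le)
    simp only [Pi.zero_apply]
    positivity
  have : (∫ r in R..(4 * R), η r ^ 2 * D r) = -∫ r in R..(4 * R), 2 * η r * d r * G r := by
    rw [hparts]; ring
  linarith

end MeridianFlow

lemma exists_forall_integral_annulus_le {f : ℝ → ℝ} (hf : Continuous f) {R₁ M : ℝ} (hR₁ : 1 ≤ R₁)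
    (hf0 : ∀ r, R₁ ≤ r → 0 ≤ f r) (hM : ∀ R, R₁ ≤ R → ∫ r in R₁..R, f r ≤ M)
    {ε : ℝ} (hε : 0 < ε) : ∃ R₀, R₁ ≤ R₀ ∧ ∀ R, R₀ ≤ R → ∫ r in R..(4 * R), f r ≤ ε := by
  set I : ℝ → ℝ := fun R => ∫ r in R₁..R, f r with hI
  have hi : ∀ a b, IntervalIntegrable f volume a b := fun a b => hf.intervalIntegrable a b
  have hbdd : BddAbove (I '' Ici R₁) := ⟨M, by rintro _ ⟨R, hR, rfl⟩; exact hM R hR⟩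
  have hne : (I '' Ici R₁).Nonempty := ⟨_, R₁, self_mem_Ici, rfl⟩
  obtain ⟨_, ⟨R₀, hR₀, rfl⟩, hlt⟩ := exists_lt_of_lt_csSup hne (sub_lt_self (sSup (I '' Ici R₁)) hε)
  have hR₀' : R₁ ≤ R₀ := hR₀
  refine ⟨R₀, hR₀, fun R hR => ?_⟩
  have h1 : I (4 * R) ≤ sSup (I '' Ici R₁) :=
    le_csSup hbdd ⟨4 * R, by simp only [mem_Ici]; linarith, rfl⟩
  have h2 : I R₀ ≤ I R := by
    have : I R₀ + ∫ r in R₀..R, f r = I R :=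
      intervalIntegral.integral_add_adjacent_intervals (hi _ _) (hi _ _)
    have : 0 ≤ ∫ r in R₀..R, f r :=
      intervalIntegral.integral_nonneg hR fun r hr => hf0 r (hR₀'.trans hr.1)
    linarith
  have h3 : I R + ∫ r in R..(4 * R), f r = I (4 * R) :=
    intervalIntegral.integral_add_adjacent_intervals (hi _ _) (hi _ _)
  linarith

lemma exists_le_of_integral_le {f : ℝ → ℝ} (hf : Continuous f) {a b c : ℝ} (hab : a < b)
    (h : ∫ r in a..b, f r ≤ c * (b - a)) : ∃ r ∈ Icc a b, f r ≤ c := by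
  by_contra! hc
  have := intervalIntegral.integral_lt_integral_of_continuousOn_of_le_of_exists_lt hab
    (continuousOn_const (c := c)) hf.continuousOn (fun r hr => (hc r (Ioc_subset_Icc_self hr)).le)
    ⟨a, left_mem_Icc.2 hab.le, hc a (left_mem_Icc.2 hab.le)⟩
  rw [intervalIntegral.integral_const, smul_eq_mul] at this
  linarith

namespace MeridianFlow

variable {R₁ : ℝ} {u w Ω : ℝ × ℝ → ℝ}

/-- Every dyadic annulus far out contains a circle on which the vorticity is small. -/
lemma exists_good_radius (h : MeridianFlow R₁ u w Ω) {ε : ℝ} (hε : 0 < ε) :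
    ∃ R₀, R₁ ≤ R₀ ∧ ∀ R, R₀ ≤ R → ∃ ρ ∈ Icc (2 * R) (3 * R), ∀ z, ρ ^ 3 * Ω (ρ, z) ^ 2 ≤ ε := by
  obtain ⟨K, hK, hdiss⟩ := h.exists_dissipation_bound
  obtain ⟨M, hM⟩ := h.dirichlet_Om
  have hpi := Real.pi_pos
  have cO := h.smooth_Om.continuous
  have cO1 := h.smooth_Om.dFst.continuous
  have cO2 := h.smooth_Om.dSnd.continuous
  have cm := continuous_integral_slice (f := fun q => dFst Ω q ^ 2) (by fun_prop) (-π) π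
  have ck := continuous_integral_slice (f := fun q => dSnd Ω q ^ 2) (by fun_prop) (-π) π
  have cH := continuous_integral_slice (f := fun q => Ω q ^ 2) (by fun_prop) (-π) π
  set m : ℝ → ℝ := fun r => ∫ z in (-π)..π, dFst Ω (r, z) ^ 2 with hm
  set k : ℝ → ℝ := fun r => ∫ z in (-π)..π, dSnd Ω (r, z) ^ 2 with hk
  set H : ℝ → ℝ := fun r => ∫ z in (-π)..π, Ω (r, z) ^ 2 with hH
  have cm' : Continuous m := cm
  have ck' : Continuous k := ck
  have cH' : Continuous H := cH
  have hH0 : ∀ r, 0 ≤ H r := fun r =>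
    intervalIntegral.integral_nonneg (by linarith) fun t _ => sq_nonneg _
  have hm0 : ∀ r, 0 ≤ m r := fun r =>
    intervalIntegral.integral_nonneg (by linarith) fun t _ => sq_nonneg _
  have hk0 : ∀ r, 0 ≤ k r := fun r =>
    intervalIntegral.integral_nonneg (by linarith) fun t _ => sq_nonneg _
  have hM' : ∀ R, R₁ ≤ R → ∫ r in R₁..R, r ^ 3 * H r ≤ M := fun R hR => by
    have := hM R hR
    simpa only [intervalIntegral.integral_const_mul] using this
  have h1 := h.one_le
  set δ : ℝ := ε / (7 * (K + 1)) with hδ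
  have hδ0 : 0 < δ := by positivity
  obtain ⟨R₀, hR₀, htail⟩ := exists_forall_integral_annulus_le
    (f := fun r => r ^ 3 * H r) (by fun_prop) h1
    (fun r hr => by have := hH0 r; have : 0 < r := by linarith
                    positivity) hM' hδ0
  refine ⟨R₀, hR₀, fun R hR => ?_⟩
  have hR1 : 1 ≤ R := by linarith
  have ht := htail R hR
  have hrH : ∫ r in R..(4 * R), r * H r ≤ ∫ r in R..(4 * R), r ^ 3 * H r := by
    refine intervalIntegral.integral_mono_on (by linarith)
      (Continuous.intervalIntegrable (by fun_prop) _ _)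
      (Continuous.intervalIntegrable (by fun_prop) _ _) fun r hr => ?_
    have hr1 : 1 ≤ r := by linarith [hr.1]
    have : r ≤ r ^ 3 := le_self_pow₀ hr1 (by norm_num)
    exact mul_le_mul_of_nonneg_right this (hH0 r)
  have hin : ∫ r in (2 * R)..(3 * R), r ^ 3 * H r ≤ ∫ r in R..(4 * R), r ^ 3 * H r := by
    refine intervalIntegral.integral_mono_interval (by linarith) (by linarith)
      (by linarith) ?_ (Continuous.intervalIntegrable (by fun_prop) _ _)
    filter_upwards [ae_restrict_mem measurableSet_Ioc] with r hr
    have := hH0 r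
    have : 0 < r := by linarith [hr.1]
    simp only [Pi.zero_apply]
    positivity
  have hd := hdiss R (hR₀.trans hR)
  have hsum : ∫ r in (2 * R)..(3 * R), (r * (m r + k r) + r ^ 3 * H r)
      ≤ ((K + 1) * δ / R) * (3 * R - 2 * R) := by
    rw [intervalIntegral.integral_add (Continuous.intervalIntegrable (by fun_prop) _ _)
      (Continuous.intervalIntegrable (by fun_prop) _ _)]
    have e : ((K + 1) * δ / R) * (3 * R - 2 * R) = (K + 1) * δ := by field_simp; ring
    rw [e]
    have : K * ∫ r in R..(4 * R), r * H r ≤ K * δ := by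
      refine mul_le_mul_of_nonneg_left (hrH.trans ht) hK.le
    linarith
  obtain ⟨ρ, hρ, hle⟩ := exists_le_of_integral_le (by fun_prop) (by linarith) hsum
  refine ⟨ρ, hρ, fun z => ?_⟩
  have hρ1 : 1 ≤ ρ := by linarith [hρ.1]
  obtain ⟨t, ht', hper⟩ := h.periodic_Om.exists_mem_Icc z
  have hsob := sq_le_integral_sq_add (φ := fun z => Ω (ρ, z)) (φ' := fun z => dSnd Ω (ρ, z))
    (fun z => hasDerivAt_dSnd (h.smooth_Om.differentiable_top _)) (by fun_prop)
    (by linarith : 0 < ρ) ht'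
  rw [hper ρ]
  change Ω (ρ, t) ^ 2 ≤ (1 + ρ) * H ρ + ρ⁻¹ * k ρ at hsob
  have e1 : ρ ^ 3 * Ω (ρ, t) ^ 2 ≤ (1 + ρ) * (ρ ^ 3 * H ρ) + ρ * (ρ * k ρ) := by
    have := mul_le_mul_of_nonneg_left hsob (by positivity : 0 ≤ ρ ^ 3)
    have e : ρ ^ 3 * ((1 + ρ) * H ρ + ρ⁻¹ * k ρ) = (1 + ρ) * (ρ ^ 3 * H ρ) + ρ * (ρ * k ρ) := by
      field_simp
    linarith
  have e2 : (1 + ρ) * (ρ ^ 3 * H ρ) + ρ * (ρ * k ρ)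
      ≤ (1 + ρ) * (ρ * (m ρ + k ρ) + ρ ^ 3 * H ρ) := by
    have := mul_nonneg (by linarith : 0 ≤ ρ) (hk0 ρ)
    have := mul_nonneg (by linarith : 0 ≤ (1 + ρ)) (mul_nonneg (by linarith : 0 ≤ ρ) (hm0 ρ))
    nlinarith
  have e3 : (1 + ρ) * (ρ * (m ρ + k ρ) + ρ ^ 3 * H ρ) ≤ (7 * R) * ((K + 1) * δ / R) := by
    have h2 := hρ.2
    have : 0 ≤ ρ * (m ρ + k ρ) + ρ ^ 3 * H ρ := by
      have := hm0 ρ; have := hk0 ρ; have := hH0 ρ; positivity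
    exact mul_le_mul (by linarith) hle this (by positivity)
  have e4 : (7 * R) * ((K + 1) * δ / R) = ε := by rw [hδ]; field_simp
  linarith

/-- Pointwise decay of the rescaled vorticity. -/
lemma exists_forall_vorticity_le (h : MeridianFlow R₁ u w Ω) {ε : ℝ} (hε : 0 < ε) :
    ∃ R₀, ∀ r, R₀ ≤ r → ∀ z, r ^ 3 * Ω (r, z) ^ 2 ≤ ε := by
  obtain ⟨R₀, hR₀, hgood⟩ := h.exists_good_radius (by positivity : 0 < ε / 8)
  refine ⟨4 * R₀, fun r hr z => ?_⟩
  have h1 := h.one_le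
  obtain ⟨a, ha, hOa⟩ := hgood (r / 4) (by linarith)
  obtain ⟨b, hb, hOb⟩ := hgood r (by linarith)
  have hr1 : 1 ≤ r := by linarith
  have ha1 : R₁ < a := by linarith [ha.1]
  have har : a ≤ r := by linarith [ha.2]
  have hrb : r ≤ b := by linarith [hb.1]
  set M := √(ε / r ^ 3) with hM
  have hMsq : M ^ 2 = ε / r ^ 3 := sq_sqrt (by positivity)
  have habs : ∀ s, r / 2 ≤ s → (∀ z, s ^ 3 * Ω (s, z) ^ 2 ≤ ε / 8) → ∀ z, |Ω (s, z)| ≤ M := by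
    intro s hs hO z
    refine abs_le_of_sq_le_sq ?_ (sqrt_nonneg _)
    rw [hMsq, le_div_iff₀ (by positivity)]
    have : (r / 2) ^ 3 ≤ s ^ 3 := by gcongr
    have := mul_le_mul_of_nonneg_right this (sq_nonneg (Ω (s, z)))
    linarith [hO z]
  have hMa := habs a (by linarith [ha.1]) hOa
  have hMb := habs b (by linarith [hb.1]) hOb
  set β : ℝ × ℝ → ℝ := fun q => u q - 3 / q.1 with hβ
  obtain ⟨B, hB⟩ := ((isCompact_Icc (a := a) (b := b)).prod
    (isCompact_Icc (a := -π) (b := π))).exists_bound_of_continuousOn h.smooth_u.continuous.continuousOn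
  have hβB : ∀ q : ℝ × ℝ, q.1 ∈ Ioo a b → β q ≤ B := by
    rintro ⟨s, t⟩ hs
    obtain ⟨t', ht', he⟩ := h.periodic_u.exists_mem_Icc t
    have hb1 := hB (s, t') ⟨Ioo_subset_Icc_self hs, ht'⟩
    have hs0 : 0 < s := by linarith [hs.1]
    have : 0 ≤ 3 / s := by positivity
    simp only [hβ, he s]
    linarith [le_abs_self (u (s, t')), Real.norm_eq_abs (u (s, t'))]
  have heq : ∀ q : ℝ × ℝ, q.1 ∈ Ioo a b →
      dFst (dFst Ω) q + dSnd (dSnd Ω) q = β q * dFst Ω q + w q * dSnd Ω q := by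
    intro q hq
    have hq0 : 0 < q.1 := by linarith [hq.1]
    have := h.vort_eq q (by linarith [hq.1])
    simp only [hβ]
    field_simp
    linarith
  have hup := le_of_le_on_boundary h.smooth_Om h.periodic_Om hβB heq
    (fun z => (abs_le.1 (hMa z)).2) (fun z => (abs_le.1 (hMb z)).2) ⟨har, hrb⟩ z
  have hlow := le_of_le_on_boundary (f := fun q => -Ω q) (γ := w) (M := M) h.smooth_Om.neg
    (fun r z => by simp only [h.periodic_Om r z]) hβB
    (fun q hq => by
      rw [dFst_neg, dSnd_neg, dFst_neg, dSnd_neg]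
      linarith [heq q hq])
    (fun z => by linarith [(abs_le.1 (hMa z)).1])
    (fun z => by linarith [(abs_le.1 (hMb z)).1]) ⟨har, hrb⟩ z
  have hfin : Ω (r, z) ^ 2 ≤ M ^ 2 := sq_le_sq' (by linarith) hup
  rw [hMsq, le_div_iff₀ (by positivity)] at hfin
  linarith

end MeridianFlow

/-- The azimuthal vorticity equation, written for `Ω = ω/r`, follows from the momentum equations
in the meridian half-plane. -/
lemma vorticity_equation {u w p Ω : ℝ × ℝ → ℝ} {c : ℝ} (hc : 0 < c)
    (hu : ContDiff ℝ (⊤ : ℕ∞) u) (hw : ContDiff ℝ (⊤ : ℕ∞) w) (hp : ContDiff ℝ (⊤ : ℕ∞) p)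
    (hΩ : ContDiff ℝ (⊤ : ℕ∞) Ω) (hω : ∀ q, q.1 * Ω q = dSnd u q - dFst w q)
    (hdiv : ∀ q : ℝ × ℝ, c < q.1 → dFst u q + u q / q.1 + dSnd w q = 0)
    (hr : ∀ q : ℝ × ℝ, c < q.1 → u q * dFst u q + w q * dSnd u q + dFst p q
      = dFst (dFst u) q + (dFst u q / q.1 - u q / q.1 ^ 2) + dSnd (dSnd u) q)
    (hz : ∀ q : ℝ × ℝ, c < q.1 → u q * dFst w q + w q * dSnd w q + dSnd p q
      = dFst (dFst w) q + dFst w q / q.1 + dSnd (dSnd w) q)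
    {q : ℝ × ℝ} (hq : c < q.1) :
    q.1 * (u q * dFst Ω q + w q * dSnd Ω q)
      = q.1 * dFst (dFst Ω) q + 3 * dFst Ω q + q.1 * dSnd (dSnd Ω) q := by
  obtain ⟨r, z⟩ := q
  simp only at hq
  have hr0 : 0 < r := hc.trans hq
  have fst {f : ℝ × ℝ → ℝ} (hf : ContDiff ℝ (⊤ : ℕ∞) f) (s t : ℝ) :
      HasDerivAt (fun s => f (s, t)) (dFst f (s, t)) s := hasDerivAt_dFst (hf.differentiable_top _)
  have snd {f : ℝ × ℝ → ℝ} (hf : ContDiff ℝ (⊤ : ℕ∞) f) (s t : ℝ) :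
      HasDerivAt (fun t => f (s, t)) (dSnd f (s, t)) t := hasDerivAt_dSnd (hf.differentiable_top _)
  have comm {f : ℝ × ℝ → ℝ} (hf : ContDiff ℝ (⊤ : ℕ∞) f) : dFst (dSnd f) = dSnd (dFst f) :=
    funext (dFst_dSnd_comm hf)
  have A1 : ∀ s t, Ω (s, t) + s * dFst Ω (s, t) = dSnd (dFst u) (s, t) - dFst (dFst w) (s, t) := by
    intro s t
    have h1 := ((hasDerivAt_id s).mul (fst hΩ s t)).unique
      (((fst hu.dSnd s t).sub (fst hw.dFst s t)).congr_of_eventuallyEq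
        (Eventually.of_forall fun s => hω (s, t)))
    rw [comm hu] at h1
    simpa using h1
  have A2 : 2 * dFst Ω (r, z) + r * dFst (dFst Ω) (r, z)
      = dSnd (dFst (dFst u)) (r, z) - dFst (dFst (dFst w)) (r, z) := by
    have h1 := ((fst hΩ r z).add ((hasDerivAt_id r).mul (fst hΩ.dFst r z))).unique
      (((fst hu.dFst.dSnd r z).sub (fst hw.dFst.dFst r z)).congr_of_eventuallyEq
        (Eventually.of_forall fun s => A1 s z))
    rw [comm hu.dFst] at h1
    simp only [id] at h1
    linarith
  have B1 : ∀ t, r * dSnd Ω (r, t) = dSnd (dSnd u) (r, t) - dSnd (dFst w) (r, t) := fun t =>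
    ((snd hΩ r t).const_mul r).unique
      (((snd hu.dSnd r t).sub (snd hw.dFst r t)).congr_of_eventuallyEq
        (Eventually.of_forall fun t => hω (r, t)))
  have B2 : r * dSnd (dSnd Ω) (r, z)
      = dSnd (dSnd (dSnd u)) (r, z) - dSnd (dSnd (dFst w)) (r, z) :=
    ((snd hΩ.dSnd r z).const_mul r).unique
      (((snd hu.dSnd.dSnd r z).sub (snd hw.dFst.dSnd r z)).congr_of_eventuallyEq
        (Eventually.of_forall B1))
  have R := ((((snd hu r z).mul (snd hu.dFst r z)).add ((snd hw r z).mul (snd hu.dSnd r z))).add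
    (snd hp.dFst r z)).unique
    ((((snd hu.dFst.dFst r z).add (((snd hu.dFst r z).div_const r).sub
      ((snd hu r z).div_const (r ^ 2)))).add (snd hu.dSnd.dSnd r z)).congr_of_eventuallyEq
      (Eventually.of_forall fun t => hr (r, t) hq))
  have Z := ((((fst hu r z).mul (fst hw.dFst r z)).add ((fst hw r z).mul (fst hw.dSnd r z))).add
    (fst hp.dSnd r z)).unique
    ((((fst hw.dFst.dFst r z).add ((fst hw.dFst r z).div (hasDerivAt_id r) hr0.ne')).add
      (fst hw.dSnd.dSnd r z)).congr_of_eventuallyEq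
      (by filter_upwards [Ioi_mem_nhds hq] with s hs using hz (s, z) hs))
  rw [comm hw.dSnd, comm hw, comm hp] at Z
  have D := hdiv (r, z) hq
  have O := hω (r, z)
  have A1' := A1 r z
  have B1' := B1 z
  simp only [id] at *
  have hi : r * r⁻¹ = 1 := mul_inv_cancel₀ hr0.ne'
  linear_combination R - Z + (u (r, z) - 1 / r) * A1' + w (r, z) * B1'
    - (dSnd u (r, z) - dFst w (r, z)) * D + (1 / r ^ 2 - u (r, z) / r) * O - A2 - B2
    + (u (r, z) * Ω (r, z) + dFst Ω (r, z) - r⁻¹ * (dFst (dFst w) (r, z) + Ω (r, z))) * hi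

section Cylindrical

lemma continuous_rr : Continuous rr := by
  unfold rr; fun_prop

lemma isOpen_lt_rr (c : ℝ) : IsOpen {x : E3 | c < rr x} := isOpen_lt continuous_const continuous_rr

lemma rr_sq (x : E3) : rr x ^ 2 = x 0 ^ 2 + x 1 ^ 2 := Real.sq_sqrt (by positivity)

lemma differentiableAt_rr {x : E3} (hx : 0 < rr x) : DifferentiableAt ℝ rr x := by
  have h : x 0 ^ 2 + x 1 ^ 2 ≠ 0 := by rw [← rr_sq]; positivity
  unfold rr
  exact DifferentiableAt.sqrt (by fun_prop) h

/-- The inclusion of the meridian half-plane `x₂ = 0`, `x₁ > 0`. -/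
def meridian : ℝ × ℝ →L[ℝ] E3 :=
  (ContinuousLinearMap.fst ℝ ℝ ℝ).smulRight (EuclideanSpace.single 0 1)
    + (ContinuousLinearMap.snd ℝ ℝ ℝ).smulRight (EuclideanSpace.single 2 1)

@[simp] lemma meridian_apply_zero (q : ℝ × ℝ) : meridian q 0 = q.1 := by simp [meridian]

@[simp] lemma meridian_apply_one (q : ℝ × ℝ) : meridian q 1 = 0 := by simp [meridian]

@[simp] lemma meridian_apply_two (q : ℝ × ℝ) : meridian q 2 = q.2 := by simp [meridian]

lemma rr_meridian {q : ℝ × ℝ} (hq : 0 ≤ q.1) : rr (meridian q) = q.1 := by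
  simp [rr, Real.sqrt_sq hq]

/-- Partial derivatives of products. -/
lemma pd_mul {f g : E3 → ℝ} {x : E3} (i : Fin 3) (hf : DifferentiableAt ℝ f x)
    (hg : DifferentiableAt ℝ g x) :
    pd i (fun y => f y * g y) x = f x * pd i g x + g x * pd i f x := by
  unfold pd
  rw [fderiv_fun_mul hf hg]
  simp

lemma pd_congr {f g : E3 → ℝ} {s : Set E3} (hs : IsOpen s) (h : ∀ y ∈ s, f y = g y) {x : E3}
    (hx : x ∈ s) (i : Fin 3) : pd i f x = pd i g x := by
  have : f =ᶠ[𝓝 x] g := by filter_upwards [hs.mem_nhds hx] with y hy using h y hy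
  unfold pd
  rw [this.fderiv_eq]

lemma pd_coord (i j : Fin 3) (x : E3) : pd i (fun y => y j) x = if j = i then 1 else 0 := by
  have h : HasFDerivAt (fun y : E3 => y j) (EuclideanSpace.proj j : E3 →L[ℝ] ℝ) x :=
    (EuclideanSpace.proj j : E3 →L[ℝ] ℝ).hasFDerivAt
  unfold pd
  rw [h.fderiv]
  simp

lemma rr_mul_pd_rr {x : E3} (hx : 0 < rr x) (i : Fin 3) :
    rr x * pd i rr x = x 0 * (if 0 = i then 1 else 0) + x 1 * (if 1 = i then 1 else 0) := by
  have hd := differentiableAt_rr hx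
  have h1 := pd_mul i hd hd
  have h2 : pd i (fun y => rr y * rr y) x = pd i (fun y => y 0 * y 0 + y 1 * y 1) x :=
    pd_congr isOpen_univ (fun y _ => by have := rr_sq y; nlinarith) (mem_univ x) i
  have h3 : pd i (fun y => y 0 * y 0 + y 1 * y 1) x
      = pd i (fun y => y 0 * y 0) x + pd i (fun y => y 1 * y 1) x := by
    unfold pd
    rw [fderiv_fun_add (by fun_prop) (by fun_prop)]
    simp
  rw [h2, h3, pd_mul i (by fun_prop) (by fun_prop), pd_mul i (by fun_prop) (by fun_prop),
    pd_coord, pd_coord] at h1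
  linarith

lemma differentiableAt_axisym {A : ℝ × ℝ → ℝ} {x : E3} (hx : 0 < rr x)
    (hA : DifferentiableAt ℝ A (rr x, x 2)) :
    DifferentiableAt ℝ (fun y => A (rr y, y 2)) x :=
  hA.comp (f := fun y : E3 => (rr y, y 2)) x ((differentiableAt_rr hx).prodMk (by fun_prop))

/-- Chain rule for functions of `(r, z)`. -/
lemma pd_axisym {A : ℝ × ℝ → ℝ} {x : E3} (hx : 0 < rr x)
    (hA : DifferentiableAt ℝ A (rr x, x 2)) (i : Fin 3) :
    pd i (fun y => A (rr y, y 2)) x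
      = dFst A (rr x, x 2) * pd i rr x + dSnd A (rr x, x 2) * (if 2 = i then 1 else 0) := by
  have hd := differentiableAt_rr hx
  have h := hA.hasFDerivAt.comp (f := fun y : E3 => (rr y, y 2)) x
    (hd.hasFDerivAt.prodMk (by fun_prop : DifferentiableAt ℝ (fun y : E3 => y 2) x).hasFDerivAt)
  have h2 := pd_coord i 2 x
  unfold pd at h2 ⊢
  change fderiv ℝ (A ∘ fun y : E3 => (rr y, y 2)) x _ = _
  rw [h.fderiv]
  simp only [ContinuousLinearMap.comp_apply, ContinuousLinearMap.prod_apply, h2]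
  unfold dFst dSnd
  generalize fderiv ℝ rr x (EuclideanSpace.single i 1) = a
  generalize (if (2 : Fin 3) = i then (1 : ℝ) else 0) = b
  have : ((a, b) : ℝ × ℝ) = a • (1, 0) + b • (0, 1) := by simp
  rw [this, map_add, map_smul, map_smul]
  simp [mul_comm]

lemma pd_zero_meridian {f : E3 → ℝ} {q : ℝ × ℝ} (hf : DifferentiableAt ℝ f (meridian q)) :
    pd 0 f (meridian q) = dFst (fun q => f (meridian q)) q := by
  have h := hf.hasFDerivAt.comp q meridian.hasFDerivAt
  unfold pd dFst
  change _ = fderiv ℝ (f ∘ meridian) q _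
  rw [h.fderiv]
  simp [meridian]

lemma pd_two_meridian {f : E3 → ℝ} {q : ℝ × ℝ} (hf : DifferentiableAt ℝ f (meridian q)) :
    pd 2 f (meridian q) = dSnd (fun q => f (meridian q)) q := by
  have h := hf.hasFDerivAt.comp q meridian.hasFDerivAt
  unfold pd dSnd
  change _ = fderiv ℝ (f ∘ meridian) q _
  rw [h.fderiv]
  simp [meridian]

lemma ContDiffOn.pd {f : E3 → ℝ} {s : Set E3} (hs : IsOpen s)
    (hf : ContDiffOn ℝ (⊤ : ℕ∞) f s) (i : Fin 3) : ContDiffOn ℝ (⊤ : ℕ∞) (pd i f) s :=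
  (hf.fderiv_of_isOpen hs (m := (⊤ : ℕ∞)) (by simp)).clm_apply contDiffOn_const

lemma differentiableAt_of_contDiffOn {f : E3 → ℝ} {s : Set E3} (hs : IsOpen s)
    (hf : ContDiffOn ℝ (⊤ : ℕ∞) f s) {x : E3} (hx : x ∈ s) : DifferentiableAt ℝ f x :=
  (hf.contDiffAt (hs.mem_nhds hx)).differentiableAt (by simp)

/-- The restriction of a function to the meridian half-plane, cut off near `r = r₀`. -/
def meridianCut (r₀ : ℝ) (f : E3 → ℝ) (q : ℝ × ℝ) : ℝ :=
  Real.smoothTransition (3 * (q.1 - r₀) - 1) * f (meridian q)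

variable {r₀ : ℝ} {f : E3 → ℝ}

lemma meridianCut_of_le {q : ℝ × ℝ} (hq : q.1 ≤ r₀ + 1 / 3) : meridianCut r₀ f q = 0 := by
  rw [meridianCut, Real.smoothTransition.zero_of_nonpos (by linarith), zero_mul]

lemma meridianCut_of_ge {q : ℝ × ℝ} (hq : r₀ + 2 / 3 ≤ q.1) :
    meridianCut r₀ f q = f (meridian q) := by
  rw [meridianCut, Real.smoothTransition.one_of_one_le (by linarith), one_mul]

lemma contDiff_meridianCut (hr₀ : 0 < r₀) (hf : ContDiffOn ℝ (⊤ : ℕ∞) f {x | r₀ < rr x}) :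
    ContDiff ℝ (⊤ : ℕ∞) (meridianCut r₀ f) := by
  rw [contDiff_iff_contDiffAt]
  intro q
  rcases lt_or_ge r₀ q.1 with h | h
  · refine ContDiffAt.mul (Real.smoothTransition.contDiffAt.comp q (by fun_prop)) ?_
    refine ContDiffAt.comp q (hf.contDiffAt ((isOpen_lt_rr r₀).mem_nhds ?_))
      meridian.contDiff.contDiffAt
    change r₀ < rr (meridian q)
    rwa [rr_meridian (by linarith)]
  · refine (contDiffAt_const (c := (0 : ℝ))).congr_of_eventuallyEq ?_
    have : Iio (r₀ + 1 / 3) ∈ 𝓝 q.1 := Iio_mem_nhds (by linarith)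
    filter_upwards [continuous_fst.continuousAt this] with y hy
    exact meridianCut_of_le (le_of_lt hy)

lemma pd_meridian_eq_zero_of_le {u : ℝ × ℝ → ℝ} (h : ∀ q : ℝ × ℝ, q.1 ≤ r₀ + 1 / 3 → u q = 0)
    {q : ℝ × ℝ} (hq : q.1 < r₀ + 1 / 3) : dFst u q = 0 ∧ dSnd u q = 0 := by
  have e : ∀ q : ℝ × ℝ, q.1 ∈ Iio (r₀ + 1 / 3) → u q = (fun _ => (0 : ℝ)) q :=
    fun q hq => h q (le_of_lt hq)
  rw [dFst_congr isOpen_Iio e hq, dSnd_congr isOpen_Iio e hq]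
  simp [dFst, dSnd]

/-- `Ω = ω/r` computed from meridian components. -/
def vorticityQuotient (u w : ℝ × ℝ → ℝ) (q : ℝ × ℝ) : ℝ := (dSnd u q - dFst w q) / q.1

lemma mul_vorticityQuotient {u w : ℝ × ℝ → ℝ} (hr₀ : 0 < r₀)
    (hu : ∀ q : ℝ × ℝ, q.1 ≤ r₀ + 1 / 3 → u q = 0) (hw : ∀ q : ℝ × ℝ, q.1 ≤ r₀ + 1 / 3 → w q = 0)
    (q : ℝ × ℝ) : q.1 * vorticityQuotient u w q = dSnd u q - dFst w q := by
  unfold vorticityQuotient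
  rcases eq_or_ne q.1 0 with h | h
  · have hq : q.1 < r₀ + 1 / 3 := by linarith
    rw [(pd_meridian_eq_zero_of_le hu hq).2, (pd_meridian_eq_zero_of_le hw hq).1]
    simp
  · field_simp

lemma contDiff_vorticityQuotient {u w : ℝ × ℝ → ℝ} (hr₀ : 0 < r₀)
    (hus : ContDiff ℝ (⊤ : ℕ∞) u) (hws : ContDiff ℝ (⊤ : ℕ∞) w)
    (hu : ∀ q : ℝ × ℝ, q.1 ≤ r₀ + 1 / 3 → u q = 0)
    (hw : ∀ q : ℝ × ℝ, q.1 ≤ r₀ + 1 / 3 → w q = 0) :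
    ContDiff ℝ (⊤ : ℕ∞) (vorticityQuotient u w) := by
  rw [contDiff_iff_contDiffAt]
  intro q
  rcases lt_or_ge 0 q.1 with h | h
  · exact (hus.dSnd.sub hws.dFst).contDiffAt.div contDiff_fst.contDiffAt h.ne'
  · refine (contDiffAt_const (c := (0 : ℝ))).congr_of_eventuallyEq ?_
    have : Iio (r₀ + 1 / 3) ∈ 𝓝 q.1 := Iio_mem_nhds (by linarith)
    filter_upwards [continuous_fst.continuousAt this] with y hy
    unfold vorticityQuotient
    rw [(pd_meridian_eq_zero_of_le hu hy).2, (pd_meridian_eq_zero_of_le hw hy).1]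
    simp

end Cylindrical

section AxisymmetricFields

variable {c : ℝ} {v : E3 → E3} {u w : ℝ × ℝ → ℝ}

lemma differentiableAt_div_fst (hu : ContDiff ℝ (⊤ : ℕ∞) u) {q : ℝ × ℝ} (hq : 0 < q.1) :
    DifferentiableAt ℝ (fun q : ℝ × ℝ => u q / q.1) q := by
  simp only [div_eq_mul_inv]
  exact (hu.differentiable_top q).mul (differentiableAt_fst.inv hq.ne')

lemma dFst_div_fst (hu : ContDiff ℝ (⊤ : ℕ∞) u) {q : ℝ × ℝ} (hq : 0 < q.1) :
    dFst (fun q : ℝ × ℝ => u q / q.1) q = dFst u q / q.1 - u q / q.1 ^ 2 := by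
  have h := (hasDerivAt_dFst (differentiableAt_div_fst hu hq)).unique
    ((hasDerivAt_dFst (hu.differentiable_top q)).div (hasDerivAt_id q.1) hq.ne')
  rw [h]
  simp only [Prod.mk.eta]
  field_simp

lemma dSnd_div_fst (hu : ContDiff ℝ (⊤ : ℕ∞) u) {q : ℝ × ℝ} (hq : 0 < q.1) :
    dSnd (fun q : ℝ × ℝ => u q / q.1) q = dSnd u q / q.1 :=
  (hasDerivAt_dSnd (differentiableAt_div_fst hu hq)).unique
    ((hasDerivAt_dSnd (hu.differentiable_top q)).div_const q.1)

lemma pd_coord_mul_axisym {A : ℝ × ℝ → ℝ} {x : E3} (hx : 0 < rr x)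
    (hA : DifferentiableAt ℝ A (rr x, x 2)) (i j : Fin 3) :
    pd i (fun y => y j * A (rr y, y 2)) x
      = x j * (dFst A (rr x, x 2) * pd i rr x + dSnd A (rr x, x 2) * (if 2 = i then 1 else 0))
        + A (rr x, x 2) * (if j = i then 1 else 0) := by
  rw [pd_mul i (by fun_prop) (differentiableAt_axisym hx hA), pd_axisym hx hA, pd_coord]

lemma pd_rr_zero {x : E3} (hx : 0 < rr x) : pd 0 rr x = x 0 / rr x := by
  have := rr_mul_pd_rr hx 0
  field_simp
  simpa [mul_comm] using this

lemma pd_rr_one {x : E3} (hx : 0 < rr x) : pd 1 rr x = x 1 / rr x := by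
  have := rr_mul_pd_rr hx 1
  field_simp
  simpa [mul_comm] using this

lemma pd_rr_two {x : E3} (hx : 0 < rr x) : pd 2 rr x = 0 := by
  have := rr_mul_pd_rr hx 2
  simpa [hx.ne'] using this

/-- The field `v` has meridian components `u`, `w` and no swirl in the region `r > c`. -/
structure HasMeridianComponents (c : ℝ) (v : E3 → E3) (u w : ℝ × ℝ → ℝ) : Prop where
  pos : 0 < c
  smooth_u : ContDiff ℝ (⊤ : ℕ∞) u
  smooth_w : ContDiff ℝ (⊤ : ℕ∞) w
  smooth_v : ∀ j, ContDiffOn ℝ (⊤ : ℕ∞) (fun y => v y j) {x : E3 | c < rr x}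
  eq_zero : ∀ x, c < rr x → v x 0 = x 0 * (u (rr x, x 2) / rr x)
  eq_one : ∀ x, c < rr x → v x 1 = x 1 * (u (rr x, x 2) / rr x)
  eq_two : ∀ x, c < rr x → v x 2 = w (rr x, x 2)

namespace HasMeridianComponents

lemma pd_zero (h : HasMeridianComponents c v u w) {x : E3} (hx : c < rr x) (i : Fin 3) :
    pd i (fun y => v y 0) x = x 0 * ((dFst u (rr x, x 2) / rr x - u (rr x, x 2) / rr x ^ 2)
      * pd i rr x + dSnd u (rr x, x 2) / rr x * (if 2 = i then 1 else 0))
      + u (rr x, x 2) / rr x * (if 0 = i then 1 else 0) := by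
  have hx0 := h.pos.trans hx
  rw [pd_congr (isOpen_lt_rr c) h.eq_zero hx,
    pd_coord_mul_axisym (A := fun q => u q / q.1) hx0 (differentiableAt_div_fst h.smooth_u hx0),
    dFst_div_fst h.smooth_u hx0, dSnd_div_fst h.smooth_u hx0]

lemma pd_one (h : HasMeridianComponents c v u w) {x : E3} (hx : c < rr x) (i : Fin 3) :
    pd i (fun y => v y 1) x = x 1 * ((dFst u (rr x, x 2) / rr x - u (rr x, x 2) / rr x ^ 2)
      * pd i rr x + dSnd u (rr x, x 2) / rr x * (if 2 = i then 1 else 0))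
      + u (rr x, x 2) / rr x * (if 1 = i then 1 else 0) := by
  have hx0 := h.pos.trans hx
  rw [pd_congr (isOpen_lt_rr c) h.eq_one hx,
    pd_coord_mul_axisym (A := fun q => u q / q.1) hx0 (differentiableAt_div_fst h.smooth_u hx0),
    dFst_div_fst h.smooth_u hx0, dSnd_div_fst h.smooth_u hx0]

lemma pd_two (h : HasMeridianComponents c v u w) {x : E3} (hx : c < rr x) (i : Fin 3) :
    pd i (fun y => v y 2) x = dFst w (rr x, x 2) * pd i rr x
      + dSnd w (rr x, x 2) * (if 2 = i then 1 else 0) := by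
  have hx0 := h.pos.trans hx
  rw [pd_congr (isOpen_lt_rr c) h.eq_two hx, pd_axisym hx0 (h.smooth_w.differentiable_top _)]

lemma le_gradSq3 (h : HasMeridianComponents c v u w) {x : E3} (hx : c < rr x) :
    dSnd u (rr x, x 2) ^ 2 + dFst w (rr x, x 2) ^ 2 + dSnd w (rr x, x 2) ^ 2 ≤ gradSq3 v x := by
  have hx0 := h.pos.trans hx
  have e1 : dSnd u (rr x, x 2) ^ 2
      = pd 2 (fun y => v y 0) x ^ 2 + pd 2 (fun y => v y 1) x ^ 2 := by
    rw [h.pd_zero hx, h.pd_one hx, pd_rr_two hx0]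
    have := rr_sq x
    simp
    field_simp
    rw [this]
  have e2 : dFst w (rr x, x 2) ^ 2
      = pd 0 (fun y => v y 2) x ^ 2 + pd 1 (fun y => v y 2) x ^ 2 := by
    rw [h.pd_two hx, h.pd_two hx, pd_rr_zero hx0, pd_rr_one hx0]
    have := rr_sq x
    simp
    field_simp
    rw [this]
  have e3 : dSnd w (rr x, x 2) = pd 2 (fun y => v y 2) x := by
    rw [h.pd_two hx, pd_rr_two hx0]; simp
  rw [e1, e2, e3]
  simp only [gradSq3, Fin.sum_univ_three]
  nlinarith [sq_nonneg (pd 0 (fun y => v y 0) x), sq_nonneg (pd 1 (fun y => v y 0) x),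
    sq_nonneg (pd 0 (fun y => v y 1) x), sq_nonneg (pd 1 (fun y => v y 1) x)]

lemma mem_region (h : HasMeridianComponents c v u w) {q : ℝ × ℝ} (hq : c < q.1) :
    meridian q ∈ {x : E3 | c < rr x} := by
  change c < rr (meridian q)
  rwa [rr_meridian (h.pos.trans hq).le]

lemma dFst_comp_meridian (h : HasMeridianComponents c v u w) {f : E3 → ℝ}
    (hf : ContDiffOn ℝ (⊤ : ℕ∞) f {x : E3 | c < rr x})
    {g : ℝ × ℝ → ℝ} (hg : ∀ q : ℝ × ℝ, c < q.1 → f (meridian q) = g q) {q : ℝ × ℝ}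
    (hq : c < q.1) : pd 0 f (meridian q) = dFst g q := by
  rw [pd_zero_meridian (differentiableAt_of_contDiffOn (isOpen_lt_rr c) hf (h.mem_region hq))]
  exact dFst_congr isOpen_Ioi hg hq

lemma dSnd_comp_meridian (h : HasMeridianComponents c v u w) {f : E3 → ℝ}
    (hf : ContDiffOn ℝ (⊤ : ℕ∞) f {x : E3 | c < rr x})
    {g : ℝ × ℝ → ℝ} (hg : ∀ q : ℝ × ℝ, c < q.1 → f (meridian q) = g q) {q : ℝ × ℝ}
    (hq : c < q.1) : pd 2 f (meridian q) = dSnd g q := by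
  rw [pd_two_meridian (differentiableAt_of_contDiffOn (isOpen_lt_rr c) hf (h.mem_region hq))]
  exact dSnd_congr isOpen_Ioi hg hq

lemma meridian_zero (h : HasMeridianComponents c v u w)
    {q : ℝ × ℝ} (hq : c < q.1) : v (meridian q) 0 = u q := by
  have hq0 := h.pos.trans hq
  rw [h.eq_zero _ (h.mem_region hq), rr_meridian hq0.le]
  simp
  field_simp

lemma meridian_one (h : HasMeridianComponents c v u w)
    {q : ℝ × ℝ} (hq : c < q.1) : v (meridian q) 1 = 0 := by
  rw [h.eq_one _ (h.mem_region hq)]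
  simp

lemma meridian_two (h : HasMeridianComponents c v u w)
    {q : ℝ × ℝ} (hq : c < q.1) : v (meridian q) 2 = w q := by
  rw [h.eq_two _ (h.mem_region hq), rr_meridian (h.pos.trans hq).le]
  simp

lemma pd_one_one_meridian (h : HasMeridianComponents c v u w) {q : ℝ × ℝ} (hq : c < q.1) :
    pd 1 (fun y => v y 1) (meridian q) = u q / q.1 := by
  rw [h.pd_one (h.mem_region hq), rr_meridian (h.pos.trans hq).le]
  simp

lemma pd_one_coord_one_mul {f g : E3 → ℝ} (hf : ∀ x ∈ {x : E3 | c < rr x}, f x = x 1 * g x)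
    {q : ℝ × ℝ} (hq : meridian q ∈ {x : E3 | c < rr x})
    (hg : DifferentiableAt ℝ g (meridian q)) :
    pd 1 f (meridian q) = g (meridian q) := by
  rw [pd_congr (isOpen_lt_rr c) hf hq, pd_mul 1 (by fun_prop) hg, pd_coord]
  simp

lemma pd_one_pd_one_zero_meridian (h : HasMeridianComponents c v u w) {q : ℝ × ℝ} (hq : c < q.1) :
    pd 1 (pd 1 (fun y => v y 0)) (meridian q) = dFst u q / q.1 - u q / q.1 ^ 2 := by
  have hq0 := h.pos.trans hq
  have hr : rr (meridian q) = q.1 := rr_meridian hq0.le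
  rw [pd_one_coord_one_mul (g := fun x => x 0 *
    (fun q : ℝ × ℝ => dFst (fun q : ℝ × ℝ => u q / q.1) q / q.1) (rr x, x 2)) ?_ (h.mem_region hq)]
  · simp only [meridian_apply_zero, meridian_apply_two, hr, Prod.mk.eta]
    rw [dFst_div_fst h.smooth_u hq0]
    field_simp
  · refine DifferentiableAt.mul (by fun_prop) (differentiableAt_axisym
      (A := fun q : ℝ × ℝ => dFst (fun q : ℝ × ℝ => u q / q.1) q / q.1) (by rwa [hr]) ?_)
    have hd : DifferentiableAt ℝ (fun q : ℝ × ℝ => (dFst u q - u q / q.1) / q.1 / q.1) q := by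
      have h1 := (differentiableAt_fst (𝕜 := ℝ) (p := q)).inv hq0.ne'
      have h2 := (h.smooth_u.dFst.differentiable_top q).sub
        (differentiableAt_div_fst h.smooth_u hq0)
      exact (h2.mul h1).mul h1
    simp only [meridian_apply_two, hr, Prod.mk.eta]
    refine hd.congr_of_eventuallyEq ?_
    filter_upwards [continuous_fst.continuousAt (Ioi_mem_nhds hq0)] with y hy
    rw [dFst_div_fst h.smooth_u hy]
    have : y.1 ≠ 0 := ne_of_gt hy
    field_simp
  · intro x hx
    have hx0 : 0 < rr x := h.pos.trans hx
    rw [h.pd_zero hx, pd_rr_one hx0]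
    simp only [dFst_div_fst (q := (rr x, x 2)) h.smooth_u hx0]
    simp
    ring

lemma pd_one_pd_one_two_meridian (h : HasMeridianComponents c v u w) {q : ℝ × ℝ} (hq : c < q.1) :
    pd 1 (pd 1 (fun y => v y 2)) (meridian q) = dFst w q / q.1 := by
  have hq0 := h.pos.trans hq
  have hr : rr (meridian q) = q.1 := rr_meridian hq0.le
  rw [pd_one_coord_one_mul (g := fun x => (fun q : ℝ × ℝ => dFst w q / q.1) (rr x, x 2)) ?_
    (h.mem_region hq)]
  · simp [hr]
  · refine differentiableAt_axisym (A := fun q : ℝ × ℝ => dFst w q / q.1) (by rwa [hr]) ?_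
    simp only [meridian_apply_two, hr, Prod.mk.eta]
    exact differentiableAt_div_fst h.smooth_w.dFst hq0
  · intro x hx
    have hx0 : 0 < rr x := h.pos.trans hx
    rw [h.pd_two hx, pd_rr_one hx0]
    simp
    ring

lemma divergence_eq (h : HasMeridianComponents c v u w)
    (hdiv : ∀ x : E3, c < rr x → (∑ i, pd i (fun y => v y i) x) = 0) {q : ℝ × ℝ} (hq : c < q.1) :
    dFst u q + u q / q.1 + dSnd w q = 0 := by
  have := hdiv _ (h.mem_region hq)
  rwa [Fin.sum_univ_three, h.dFst_comp_meridian (h.smooth_v 0) (fun q => h.meridian_zero) hq,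
    h.pd_one_one_meridian hq,
    h.dSnd_comp_meridian (h.smooth_v 2) (fun q => h.meridian_two) hq] at this

lemma momentum_radial (h : HasMeridianComponents c v u w)
    {p : E3 → ℝ} {P : ℝ × ℝ → ℝ} (hp : ContDiffOn ℝ (⊤ : ℕ∞) p {x : E3 | c < rr x})
    (hP : ∀ q : ℝ × ℝ, c < q.1 → p (meridian q) = P q)
    (hmom : ∀ x : E3, c < rr x → ∀ j : Fin 3,
      (∑ i, v x i * pd i (fun y => v y j) x) + pd j p x
        = ∑ i, pd i (pd i (fun y => v y j)) x)
    {q : ℝ × ℝ} (hq : c < q.1) :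
    u q * dFst u q + w q * dSnd u q + dFst P q
      = dFst (dFst u) q + (dFst u q / q.1 - u q / q.1 ^ 2) + dSnd (dSnd u) q := by
  have e0 := fun (q : ℝ × ℝ) (hq : c < q.1) =>
    h.dFst_comp_meridian (h.smooth_v 0) (fun q => h.meridian_zero) hq
  have e2 := fun (q : ℝ × ℝ) (hq : c < q.1) =>
    h.dSnd_comp_meridian (h.smooth_v 0) (fun q => h.meridian_zero) hq
  have := hmom _ (h.mem_region hq) 0
  rw [Fin.sum_univ_three, Fin.sum_univ_three, h.meridian_zero hq, h.meridian_one hq,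
    h.meridian_two hq, e0 q hq, e2 q hq, h.dFst_comp_meridian hp hP hq,
    h.dFst_comp_meridian ((h.smooth_v 0).pd (isOpen_lt_rr c) 0) e0 hq,
    h.dSnd_comp_meridian ((h.smooth_v 0).pd (isOpen_lt_rr c) 2) e2 hq,
    h.pd_one_pd_one_zero_meridian hq] at this
  linarith

lemma momentum_axial (h : HasMeridianComponents c v u w)
    {p : E3 → ℝ} {P : ℝ × ℝ → ℝ} (hp : ContDiffOn ℝ (⊤ : ℕ∞) p {x : E3 | c < rr x})
    (hP : ∀ q : ℝ × ℝ, c < q.1 → p (meridian q) = P q)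
    (hmom : ∀ x : E3, c < rr x → ∀ j : Fin 3,
      (∑ i, v x i * pd i (fun y => v y j) x) + pd j p x
        = ∑ i, pd i (pd i (fun y => v y j)) x)
    {q : ℝ × ℝ} (hq : c < q.1) :
    u q * dFst w q + w q * dSnd w q + dSnd P q
      = dFst (dFst w) q + dFst w q / q.1 + dSnd (dSnd w) q := by
  have e0 := fun (q : ℝ × ℝ) (hq : c < q.1) =>
    h.dFst_comp_meridian (h.smooth_v 2) (fun q => h.meridian_two) hq
  have e2 := fun (q : ℝ × ℝ) (hq : c < q.1) =>
    h.dSnd_comp_meridian (h.smooth_v 2) (fun q => h.meridian_two) hq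
  have := hmom _ (h.mem_region hq) 2
  rw [Fin.sum_univ_three, Fin.sum_univ_three, h.meridian_zero hq, h.meridian_one hq,
    h.meridian_two hq, e0 q hq, e2 q hq, h.dSnd_comp_meridian hp hP hq,
    h.dFst_comp_meridian ((h.smooth_v 2).pd (isOpen_lt_rr c) 0) e0 hq,
    h.dSnd_comp_meridian ((h.smooth_v 2).pd (isOpen_lt_rr c) 2) e2 hq,
    h.pd_one_pd_one_two_meridian hq] at this
  linarith

end HasMeridianComponents

end AxisymmetricFields

section CylindricalIntegral

/-- Integration in cylindrical coordinates of functions of `(r, z)`. -/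
lemma lintegral_axisym {G : ℝ × ℝ → ENNReal} (hG : Measurable G) :
    ∫⁻ x : E3, G (rr x, x 2)
      = ENNReal.ofReal (2 * π) *
        ∫⁻ q, ENNReal.ofReal q.1 * G q ∂((volume.restrict (Ioi (0 : ℝ))).prod volume) := by
  have mp := (((MeasurePreserving.id (volume : Measure ℝ)).prod
    (volume_preserving_finTwoArrow ℝ)).comp
      (volume_preserving_piFinSuccAbove (fun _ : Fin 3 => ℝ) 2)).comp
      (PiLp.volume_preserving_ofLp (Fin 3))
  have hm : Measurable fun y : ℝ × ℝ × ℝ => G (Real.sqrt (y.2.1 ^ 2 + y.2.2 ^ 2), y.1) :=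
    hG.comp (by fun_prop)
  have h1 : ∫⁻ x : E3, G (rr x, x 2)
      = ∫⁻ y : ℝ × ℝ × ℝ, G (Real.sqrt (y.2.1 ^ 2 + y.2.2 ^ 2), y.1) :=
    mp.lintegral_comp hm
  have h2 : ∀ z : ℝ, ∫⁻ p : ℝ × ℝ, G (Real.sqrt (p.1 ^ 2 + p.2 ^ 2), z)
      = ENNReal.ofReal (2 * π) * ∫⁻ r in Ioi (0 : ℝ), ENNReal.ofReal r * G (r, z) := by
    intro z
    have hm2 : Measurable fun q : ℝ × ℝ => ENNReal.ofReal q.1 * G (q.1, z) :=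
      (ENNReal.measurable_ofReal.comp measurable_fst).mul (hG.comp (by fun_prop))
    have hm3 : Measurable fun r : ℝ => ENNReal.ofReal r * G (r, z) :=
      ENNReal.measurable_ofReal.mul (hG.comp (by fun_prop))
    rw [← lintegral_comp_polarCoord_symm]
    have h3 : ∀ q ∈ polarCoord.target, ENNReal.ofReal q.1 •
        G (Real.sqrt ((polarCoord.symm q).1 ^ 2 + (polarCoord.symm q).2 ^ 2), z)
          = ENNReal.ofReal q.1 * G (q.1, z) := by
      intro q hq
      rw [polarCoord_target] at hq
      have : (polarCoord.symm q).1 ^ 2 + (polarCoord.symm q).2 ^ 2 = q.1 ^ 2 := by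
        rw [polarCoord_symm_apply]
        linear_combination q.1 ^ 2 * Real.sin_sq_add_cos_sq q.2
      rw [this, Real.sqrt_sq (le_of_lt hq.1), smul_eq_mul]
    rw [setLIntegral_congr_fun polarCoord.open_target.measurableSet h3, polarCoord_target,
      Measure.volume_eq_prod, ← Measure.prod_restrict, lintegral_prod _ hm2.aemeasurable]
    simp only [lintegral_const, Measure.restrict_apply_univ, Real.volume_Ioo]
    rw [lintegral_mul_const _ hm3, mul_comm]
    congr 2
    ring
  rw [h1, Measure.volume_eq_prod, lintegral_prod _ hm.aemeasurable]
  simp only [h2]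
  rw [lintegral_const_mul', lintegral_prod_symm]
  · exact ((ENNReal.measurable_ofReal.comp measurable_fst).mul hG).aemeasurable
  · exact ENNReal.ofReal_ne_top

lemma exists_forall_integral_le_of_dirichlet {r₀ R₁ C : ℝ} (hR : r₀ ≤ R₁) (hR₁ : 0 < R₁)
    (hC : 0 ≤ C) {g : E3 → ℝ} {F : ℝ × ℝ → ℝ} (hF : Continuous F) (hF0 : ∀ q, 0 ≤ F q)
    (hg : ∀ x : E3, R₁ < rr x → F (rr x, x 2) ≤ C * g x)
    (hdiri : ∫⁻ x : E3 in {x : E3 | r₀ < rr x ∧ x 2 ∈ Icc (-π) π}, ENNReal.ofReal (g x) < ⊤) :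
    ∃ M : ℝ, ∀ R, R₁ ≤ R → ∫ r in R₁..R, ∫ z in (-π)..π, r * F (r, z) ≤ M := by
  set I := ∫⁻ x : E3 in {x : E3 | r₀ < rr x ∧ x 2 ∈ Icc (-π) π}, ENNReal.ofReal (g x) with hI
  have hpi := Real.pi_gt_three
  refine ⟨(ENNReal.ofReal C * I).toReal, fun R hRR => ?_⟩
  have hfin : ENNReal.ofReal C * I ≠ ⊤ := ENNReal.mul_ne_top ENNReal.ofReal_ne_top hdiri.ne
  set S : Set (ℝ × ℝ) := Ioc R₁ R ×ˢ Ioc (-π) π with hS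
  have hSm : MeasurableSet S := measurableSet_Ioc.prod measurableSet_Ioc
  set G : ℝ × ℝ → ENNReal := S.indicator fun q => ENNReal.ofReal (F q) with hG
  have hGm : Measurable G := (ENNReal.measurable_ofReal.comp hF.measurable).indicator hSm
  have hSset : MeasurableSet {x : E3 | r₀ < rr x ∧ x 2 ∈ Icc (-π) π} :=
    (isOpen_lt_rr r₀).measurableSet.inter
      (measurableSet_Icc.preimage (by fun_prop : Measurable fun x : E3 => x 2))
  have h1 : ∫⁻ x : E3, G (rr x, x 2) ≤ ENNReal.ofReal C * I := by
    rw [hI, ← lintegral_const_mul' _ _ ENNReal.ofReal_ne_top, ← lintegral_indicator hSset]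
    refine lintegral_mono fun x => ?_
    by_cases hx : (rr x, x 2) ∈ S
    · have hx1 : R₁ < rr x := hx.1.1
      have hx2 : x ∈ {x : E3 | r₀ < rr x ∧ x 2 ∈ Icc (-π) π} :=
        ⟨hR.trans_lt hx1, Ioc_subset_Icc_self hx.2⟩
      rw [hG, indicator_of_mem hx, indicator_of_mem hx2, ← ENNReal.ofReal_mul hC]
      exact ENNReal.ofReal_le_ofReal (hg x hx1)
    · rw [hG, indicator_of_notMem hx]
      exact zero_le
  rw [lintegral_axisym hGm] at h1
  have hint : IntegrableOn (fun q : ℝ × ℝ => q.1 * F q) S (volume.prod volume) :=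
    ((by fun_prop : Continuous fun q : ℝ × ℝ => q.1 * F q).continuousOn.integrableOn_compact
      (isCompact_Icc.prod isCompact_Icc)).mono_set
      (prod_mono Ioc_subset_Icc_self Ioc_subset_Icc_self)
  have h2 : ∫ r in R₁..R, ∫ z in (-π)..π, r * F (r, z)
      = ∫ q in S, q.1 * F q ∂(volume.prod volume) := by
    rw [intervalIntegral.integral_of_le hRR, hS, setIntegral_prod _ hint]
    refine setIntegral_congr_fun measurableSet_Ioc fun r _ => ?_
    exact intervalIntegral.integral_of_le (by linarith)
  have hnn : 0 ≤ᵐ[(volume.prod volume).restrict S] fun q : ℝ × ℝ => q.1 * F q :=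
    (ae_restrict_iff' hSm).2 (ae_of_all _ fun q hq =>
      mul_nonneg (hR₁.le.trans hq.1.1.le) (hF0 q))
  have hprod : ((volume : Measure ℝ).restrict (Ioi 0)).prod (volume : Measure ℝ)
      = (volume.prod volume).restrict (Ioi 0 ×ˢ univ) := by
    rw [← Measure.prod_restrict, Measure.restrict_univ]
  have h3 : ENNReal.ofReal (∫ q in S, q.1 * F q ∂(volume.prod volume))
      ≤ ∫⁻ q, ENNReal.ofReal q.1 * G q ∂((volume.restrict (Ioi (0 : ℝ))).prod volume) := by
    rw [ofReal_integral_eq_lintegral_ofReal hint hnn, ← lintegral_indicator hSm,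
      hprod, ← lintegral_indicator (measurableSet_Ioi.prod MeasurableSet.univ)]
    refine lintegral_mono fun q => ?_
    by_cases hq : q ∈ S
    · have hq0 : 0 < q.1 := hR₁.trans hq.1.1
      rw [indicator_of_mem hq, indicator_of_mem (s := Ioi (0 : ℝ) ×ˢ univ) ⟨hq0, mem_univ _⟩, hG, indicator_of_mem hq,
        ENNReal.ofReal_mul hq0.le]
    · rw [indicator_of_notMem hq]
      exact zero_le
  have h4 : (1 : ENNReal) ≤ ENNReal.ofReal (2 * π) := by
    rw [ENNReal.one_le_ofReal]; linarith
  rw [h2, ← ENNReal.ofReal_le_iff_le_toReal hfin]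
  exact (h3.trans (le_mul_of_one_le_left' h4)).trans h1

end CylindricalIntegral

section Conclusion

variable {r₀ : ℝ} {v : E3 → E3} {p : E3 → ℝ} {vr vz : ℝ → ℝ → ℝ}

namespace AxisymNoSwirlNSSlab

lemma smooth_component (hsol : AxisymNoSwirlNSSlab r₀ v p vr vz)
    (j : Fin 3) :
    ContDiffOn ℝ (⊤ : ℕ∞) (fun y => v y j) {x : E3 | r₀ < rr x} :=
  (EuclideanSpace.proj j : E3 →L[ℝ] ℝ).contDiff.comp_contDiffOn hsol.smooth_v

lemma cut_zero_eq (hsol : AxisymNoSwirlNSSlab r₀ v p vr vz)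
    (hr₀ : 0 < r₀) {q : ℝ × ℝ} (hq : r₀ + 2 / 3 < q.1) :
    meridianCut r₀ (fun y => v y 0) q = vr q.1 q.2 := by
  have hq0 : 0 < q.1 := by linarith
  have hr : rr (meridian q) = q.1 := rr_meridian hq0.le
  rw [meridianCut_of_ge hq.le, (hsol.axisym_no_swirl _ (by rw [hr]; linarith)).1, hr]
  simp [hq0.ne']

lemma cut_two_eq (hsol : AxisymNoSwirlNSSlab r₀ v p vr vz)
    (hr₀ : 0 < r₀) {q : ℝ × ℝ} (hq : r₀ + 2 / 3 < q.1) :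
    meridianCut r₀ (fun y => v y 2) q = vz q.1 q.2 := by
  have hr : rr (meridian q) = q.1 := rr_meridian (by linarith)
  rw [meridianCut_of_ge hq.le, (hsol.axisym_no_swirl _ (by rw [hr]; linarith)).2.2, hr]
  simp

lemma periodicSnd_cut (hsol : AxisymNoSwirlNSSlab r₀ v p vr vz)
    (j : Fin 3) : PeriodicSnd (meridianCut r₀ fun y => v y j) := by
  intro r z
  have h : meridian (r, z + 2 * π)
      = meridian (r, z) + (2 * π) • EuclideanSpace.single (2 : Fin 3) (1 : ℝ) := by
    simp [meridian, add_smul, add_assoc]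
  simp only [meridianCut, h, hsol.periodic]

lemma hasMeridianComponents (hsol : AxisymNoSwirlNSSlab r₀ v p vr vz)
    (hr₀ : 0 < r₀) : HasMeridianComponents (r₀ + 2 / 3) v
    (meridianCut r₀ fun y => v y 0) (meridianCut r₀ fun y => v y 2) where
  pos := by linarith
  smooth_u := contDiff_meridianCut hr₀ (hsol.smooth_component 0)
  smooth_w := contDiff_meridianCut hr₀ (hsol.smooth_component 2)
  smooth_v j := (hsol.smooth_component j).mono fun x hx =>
    lt_trans (by linarith : r₀ < r₀ + 2 / 3) hx
  eq_zero x hx := by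
    rw [hsol.cut_zero_eq hr₀ (q := (rr x, x 2)) hx, (hsol.axisym_no_swirl x (by linarith)).1]
    ring
  eq_one x hx := by
    rw [hsol.cut_zero_eq hr₀ (q := (rr x, x 2)) hx, (hsol.axisym_no_swirl x (by linarith)).2.1]
    ring
  eq_two x hx := by
    rw [hsol.cut_two_eq hr₀ (q := (rr x, x 2)) hx, (hsol.axisym_no_swirl x (by linarith)).2.2]

lemma meridianFlow (hsol : AxisymNoSwirlNSSlab r₀ v p vr vz)
    (hr₀ : 0 < r₀)
    (hdiri : ∫⁻ x : E3 in {x : E3 | r₀ < rr x ∧ x 2 ∈ Icc (-π) π},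
      ENNReal.ofReal (gradSq3 v x) < ⊤) :
    MeridianFlow (r₀ + 1) (meridianCut r₀ fun y => v y 0) (meridianCut r₀ fun y => v y 2)
      (vorticityQuotient (meridianCut r₀ fun y => v y 0) (meridianCut r₀ fun y => v y 2)) := by
  have hc := hsol.hasMeridianComponents hr₀
  have hpu := hsol.periodicSnd_cut 0
  have hpw := hsol.periodicSnd_cut 2
  have hu0 : ∀ q : ℝ × ℝ, q.1 ≤ r₀ + 1 / 3 → meridianCut r₀ (fun y => v y 0) q = 0 :=
    fun q hq => meridianCut_of_le hq
  have hw0 : ∀ q : ℝ × ℝ, q.1 ≤ r₀ + 1 / 3 → meridianCut r₀ (fun y => v y 2) q = 0 :=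
    fun q hq => meridianCut_of_le hq
  have hP := contDiff_meridianCut hr₀ hsol.smooth_p
  have hPeq : ∀ q : ℝ × ℝ, r₀ + 2 / 3 < q.1 → p (meridian q) = meridianCut r₀ p q :=
    fun q hq => (meridianCut_of_ge hq.le).symm
  have hp : ContDiffOn ℝ (⊤ : ℕ∞) p {x : E3 | r₀ + 2 / 3 < rr x} :=
    hsol.smooth_p.mono fun x hx => lt_trans (by linarith : r₀ < r₀ + 2 / 3) hx
  have hmom := fun (x : E3) (hx : r₀ + 2 / 3 < rr x) => hsol.momentum x (by linarith)
  have hdiv := fun (x : E3) (hx : r₀ + 2 / 3 < rr x) => hsol.incompressible x (by linarith)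
  generalize meridianCut r₀ (fun y => v y 0) = u at *
  generalize meridianCut r₀ (fun y => v y 2) = w at *
  have hus := hc.smooth_u
  have hws := hc.smooth_w
  have hω := mul_vorticityQuotient hr₀ hu0 hw0
  have hΩ := contDiff_vorticityQuotient hr₀ hus hws hu0 hw0
  refine ⟨by linarith, hus, hws, hΩ, hpw, hpu, fun r z => ?_, fun q hq => ?_, fun q hq => ?_,
    ?_, ?_⟩
  · simp only [vorticityQuotient, hpu.dSnd r z, hpw.dFst r z]
  · have hq0 : 0 < q.1 := by linarith
    have := hc.divergence_eq hdiv (q := q) (by linarith)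
    field_simp at this
    linarith
  · exact vorticity_equation hc.pos hus hws hP hΩ hω (fun q => hc.divergence_eq hdiv)
      (fun q => hc.momentum_radial hp hPeq hmom) (fun q => hc.momentum_axial hp hPeq hmom)
      (by linarith)
  · refine exists_forall_integral_le_of_dirichlet (r₀ := r₀) (F := fun q => dSnd w q ^ 2) (C := 1)
      (by linarith) (by linarith) zero_le_one (hws.dSnd.continuous.pow 2) (fun q => sq_nonneg _)
      (fun x hx => ?_) hdiri
    have := hc.le_gradSq3 (x := x) (by linarith)
    linarith [sq_nonneg (dSnd u (rr x, x 2)), sq_nonneg (dFst w (rr x, x 2))]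
  · obtain ⟨M, hM⟩ := exists_forall_integral_le_of_dirichlet (r₀ := r₀) (R₁ := r₀ + 1)
      (F := fun q => (dSnd u q - dFst w q) ^ 2) (C := 2) (by linarith) (by linarith) zero_le_two
      ((hus.dSnd.continuous.sub hws.dFst.continuous).pow 2) (fun q => sq_nonneg _)
      (fun x hx => by
        have := hc.le_gradSq3 (x := x) (by linarith)
        nlinarith [sq_nonneg (dSnd u (rr x, x 2) + dFst w (rr x, x 2)),
          sq_nonneg (dSnd w (rr x, x 2))]) hdiri
    refine ⟨M, fun R hR => le_of_eq_of_le ?_ (hM R hR)⟩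
    congr! 4 with r z
    rw [← hω (r, z)]
    ring

lemma omTheta_eq (hsol : AxisymNoSwirlNSSlab r₀ v p vr vz)
    (hr₀ : 0 < r₀) {r : ℝ} (hr : r₀ + 2 / 3 < r) (z : ℝ) :
    omTheta vr vz r z = r * vorticityQuotient (meridianCut r₀ fun y => v y 0)
      (meridianCut r₀ fun y => v y 2) (r, z) := by
  have hc := hsol.hasMeridianComponents hr₀
  rw [show r = ((r, z) : ℝ × ℝ).1 from rfl, mul_vorticityQuotient hr₀
    (fun q hq => meridianCut_of_le hq) (fun q hq => meridianCut_of_le hq), omTheta, dzz, dr]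
  congr 1
  · refine ((hasDerivAt_dSnd (hc.smooth_u.differentiable_top (r, z))).congr_of_eventuallyEq
      (Eventually.of_forall fun t => ?_)).deriv
    exact (hsol.cut_zero_eq hr₀ (q := (r, t)) hr).symm
  · refine ((hasDerivAt_dFst (hc.smooth_w.differentiable_top (r, z))).congr_of_eventuallyEq
      ?_).deriv
    filter_upwards [Ioi_mem_nhds hr] with s hs
    exact (hsol.cut_two_eq hr₀ (q := (s, z)) hs).symm

end AxisymNoSwirlNSSlab

end Conclusion

/-- decay of `ω^θ` in Theorem 1.1 for `q = 2`:
`r^{1/2} sup_z |ω^θ(r,z)| → 0` as `r → ∞`. -/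
theorem omega_decay_q_eq_two (r₀ : ℝ) (hr₀ : 0 < r₀)
    (v : E3 → E3) (p : E3 → ℝ) (vr vz : ℝ → ℝ → ℝ)
    (hsol : AxisymNoSwirlNSSlab r₀ v p vr vz)
    (hdiri : ∫⁻ x : E3 in {x : E3 | r₀ < rr x ∧ x 2 ∈ Icc (-π) π},
      ENNReal.ofReal (gradSq3 v x) < ⊤) :
    Tendsto
      (fun r : ℝ => r ^ ((1 : ℝ) / 2) *
        ⨆ z : (Icc (-π) π : Set ℝ), |omTheta vr vz r (z : ℝ)|)
      atTop (𝓝 0) := by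
  have hpi := Real.pi_gt_three
  have hne : Nonempty (Icc (-π) π : Set ℝ) := ⟨⟨0, by constructor <;> linarith⟩⟩
  rw [Metric.tendsto_atTop]
  intro ε hε
  obtain ⟨R₀, hR₀⟩ := (hsol.meridianFlow hr₀ hdiri).exists_forall_vorticity_le
    (ε := (ε / 2) ^ 2) (by positivity)
  refine ⟨max R₀ (r₀ + 1), fun r hr => ?_⟩
  have hr1 : R₀ ≤ r := (le_max_left _ _).trans hr
  have hr2 : r₀ + 1 ≤ r := (le_max_right _ _).trans hr
  have hr3 : 0 < r := by linarith
  have hsq : 0 < √r := Real.sqrt_pos.2 hr3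
  rw [← Real.sqrt_eq_rpow, Real.dist_eq, sub_zero,
    abs_of_nonneg (mul_nonneg hsq.le (Real.iSup_nonneg fun _ => abs_nonneg _))]
  have key : ⨆ z : (Icc (-π) π : Set ℝ), |omTheta vr vz r (z : ℝ)| ≤ ε / 2 / √r := by
    refine ciSup_le fun z => ?_
    rw [le_div_iff₀ hsq]
    refine abs_le_of_sq_le_sq' ?_ (by positivity) |>.2
    rw [mul_pow, Real.sq_sqrt hr3.le, sq_abs, hsol.omTheta_eq hr₀ (by linarith)]
    refine le_of_eq_of_le ?_ (hR₀ r hr1 z)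
    ring
  calc √r * ⨆ z : (Icc (-π) π : Set ℝ), |omTheta vr vz r (z : ℝ)|
      ≤ √r * (ε / 2 / √r) := by gcongr
    _ = ε / 2 := by field_simp
    _ < ε := by linarith
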